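/- arXiv:0810.4609 — 3 statements merged into one kernel-verified Lean document; each statement's English description precedes it below -/
import Mathlib

section
/- Let 𝒳 be a separable real Hilbert space and (P_t)_{t≥0} a Feller, stochastically continuous Markov transition semigroup on 𝒳 with the e-property. Let Y : 𝒳 × [0,∞) → 𝒳, (x,t) ↦ Y^x(t), be a semi-dynamical system (Y^x(0) = x, t ↦ Y^x(t) continuous, x ↦ Y^x(t) Borel measurable, and Y^{Y^x(t)}(s) = Y^x(t+s)). Assume: (i) Y has a compact global attractor 𝒦 (𝒦 is compact, Y^x(t) ∈ 𝒦 for all x ∈ 𝒦 and t ≥ 0, and for all ε, R > 0 there is T such that Y^x(t) ∈ 𝒦 + εB(0,1) whenever t ≥ T and ‖x‖ ≤ R); (ii) there is a Lyapunov function Φ (Borel measurable, bounded on bounded sets, Φ(x) → ∞ as ‖x‖ → ∞) with sup_{t≥0} ∫ Φ(y) P_t(x,dy) < ∞ for every x ∈ 𝒳; (iii) stochastic stability: for all ε, R, t > 0, inf_{‖x‖≤R} P_t(x, B(Y^x(t), ε)) > 0, and ⋂_{x∈𝒦} ⋃_{t≥0} supp(P_t*δ_x) ≠ ∅. Then (P_t)_{t≥0}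 admits a unique invariant probability measure μ* and is weak-* mean ergodic: Q^T ν → μ* weakly as T → ∞ for every Borel probability measure ν on 𝒳. -/
open MeasureTheory Filter Topology Metric Set

noncomputable section

/-- A Markov transition semigroup on a measurable space `X`: a jointly measurable family
of Markov probability kernels `P t x` with `P 0 x = δ_x` and the Chapman–Kolmogorov
semigroup property for nonnegative times. -/
structure MarkovSemigroup (X : Type*) [MeasurableSpace X] where
  P : ℝ → X → MeasureTheory.Measure X
  prob : ∀ t x, MeasureTheory.IsProbabilityMeasure (P t x)
  meas : Measurable fun p : ℝ × X => P p.1 p.2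
  init : ∀ x : X, P 0 x = MeasureTheory.Measure.dirac x
  semigroup : ∀ t s : ℝ, 0 ≤ t → 0 ≤ s → ∀ x : X,
    P (t + s) x = (P t x).bind (P s)

namespace MarkovSemigroup

variable {X : Type*} [MeasurableSpace X]

/-- Action `P_t f(x) = ∫ f(y) P_t(x,dy)` on functions. -/
def act (M : MarkovSemigroup X) (t : ℝ) (f : X → ℝ) (x : X) : ℝ :=
  ∫ y, f y ∂(M.P t x)

/-- Dual action `P_t^* μ` on measures. -/
def dual (M : MarkovSemigroup X) (t : ℝ) (μ : MeasureTheory.Measure X) :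
    MeasureTheory.Measure X :=
  μ.bind (M.P t)

/-- The time average `Q^T μ = (1/T) ∫_0^T P_s^* μ ds` (with the convention
`Q^T μ = μ` for `T ≤ 0`). -/
def QM (M : MarkovSemigroup X) (T : ℝ) (μ : MeasureTheory.Measure X) :
    MeasureTheory.Measure X :=
  if T ≤ 0 then μ
  else ((ENNReal.ofReal (1 / T)) • (volume.restrict (Set.Ioc (0 : ℝ) T))).bind
    fun s => M.dual s μ

/-- `Q^T(x,·) := Q^T δ_x`. -/
def Q (M : MarkovSemigroup X) (T : ℝ) (x : X) : MeasureTheory.Measure X :=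
  M.QM T (MeasureTheory.Measure.dirac x)

/-- Iterated averages: for `ts = [t_k, …, t_1]`, `QMs ts μ = Q^{t_k}(⋯(Q^{t_1} μ)⋯)`. -/
def QMs (M : MarkovSemigroup X) (ts : List ℝ) (μ : MeasureTheory.Measure X) :
    MeasureTheory.Measure X :=
  ts.foldr (fun t ν => M.QM t ν) μ

/-- A measure is invariant if `P_t^* μ = μ` for all `t ≥ 0`. -/
def Invariant (M : MarkovSemigroup X) (μ : MeasureTheory.Measure X) : Prop :=
  ∀ t : ℝ, 0 ≤ t → M.dual t μ = μ

section TopologicalDefs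

variable [TopologicalSpace X]

/-- Bounded continuous real functions. -/
def IsBddContinuous (f : X → ℝ) : Prop :=
  Continuous f ∧ ∃ C : ℝ, ∀ x, |f x| ≤ C

/-- The Feller property: `P_t` maps bounded continuous functions to continuous ones. -/
def Feller (M : MarkovSemigroup X) : Prop :=
  ∀ t : ℝ, 0 ≤ t → ∀ f : X → ℝ, MarkovSemigroup.IsBddContinuous f →
    Continuous (M.act t f)

/-- Stochastic continuity: `P_t f(x) → f(x)` as `t → 0+`. -/
def StochasticallyContinuous (M : MarkovSemigroup X) : Prop :=
  ∀ f : X → ℝ, MarkovSemigroup.IsBddContinuous f → ∀ x : X,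
    Filter.Tendsto (fun t : ℝ => M.act t f x) (nhdsWithin 0 (Set.Ioi 0)) (nhds (f x))

/-- Weak convergence of `Q^T ν` to `μ` as `T → ∞`. -/
def QTendsto (M : MarkovSemigroup X) (ν μ : MeasureTheory.Measure X) : Prop :=
  ∀ f : X → ℝ, MarkovSemigroup.IsBddContinuous f →
    Filter.Tendsto (fun T : ℝ => ∫ x, f x ∂(M.QM T ν)) Filter.atTop
      (nhds (∫ x, f x ∂μ))

/-- Weak-* mean ergodicity with limit `μstar`. -/
def WeakStarMeanErgodic (M : MarkovSemigroup X) (μstar : MeasureTheory.Measure X) : Prop :=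
  ∀ ν : MeasureTheory.Measure X, MeasureTheory.IsProbabilityMeasure ν → M.QTendsto ν μstar

/-- Tightness of the family `(Q^T(x,·))_{T>0}`. -/
def TightAt (M : MarkovSemigroup X) (x : X) : Prop :=
  ∀ ε : ℝ, 0 < ε → ∃ K : Set X, IsCompact K ∧
    ∀ T : ℝ, 0 < T → 1 - ε ≤ ((M.Q T x) K).toReal

end TopologicalDefs

end MarkovSemigroup

/-- Topological support of a measure: points all of whose open neighborhoods
have positive mass. -/
def msupport {X : Type*} [MeasurableSpace X] [TopologicalSpace X]
    (μ : MeasureTheory.Measure X) : Set X :=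
  {x : X | ∀ U : Set X, IsOpen U → x ∈ U → 0 < μ U}

/-- Total variation distance between two (finite) measures, as the supremum over
Borel sets of the discrepancy of masses. -/
def tvDist {X : Type*} [MeasurableSpace X] (μ ν : MeasureTheory.Measure X) : ℝ :=
  ⨆ B : {B : Set X // MeasurableSet B}, |(μ B.1).toReal - (ν B.1).toReal|

section MetricDefs

variable {X : Type*} [MeasurableSpace X] [PseudoMetricSpace X]

/-- Bounded Lipschitz real functions. -/
def IsBddLipschitz (ψ : X → ℝ) : Prop :=
  (∃ K : NNReal, LipschitzWith K ψ) ∧ ∃ C : ℝ, ∀ x, |ψ x| ≤ C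

/-- The e-property: equicontinuity of `(P_t ψ)_{t ≥ 0}` at every point, for every
bounded Lipschitz `ψ`. -/
def MarkovSemigroup.EProperty (M : MarkovSemigroup X) : Prop :=
  ∀ ψ : X → ℝ, IsBddLipschitz ψ → ∀ x : X, ∀ ε : ℝ, 0 < ε →
    ∃ δ : ℝ, 0 < δ ∧ ∀ z : X, dist z x < δ → ∀ t : ℝ, 0 ≤ t →
      |M.act t ψ z - M.act t ψ x| < ε

end MetricDefs

theorem integral_bind_of_bounded {α β : Type*} [MeasurableSpace α] [MeasurableSpace β]
    {m : Measure α} [IsFiniteMeasure m] {κ : α → Measure β} (hκ : Measurable κ)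
    (hp : ∀ a, IsProbabilityMeasure (κ a)) {f : β → ℝ} (hf : Measurable f) {C : ℝ}
    (hC : ∀ x, |f x| ≤ C) :
    ∫ x, f x ∂(m.bind κ) = ∫ a, ∫ x, f x ∂(κ a) ∂m := by
  let η : ProbabilityTheory.Kernel α β := ⟨κ, hκ⟩
  have : ProbabilityTheory.IsMarkovKernel η := ⟨hp⟩
  have h := ProbabilityTheory.Kernel.integral_comp (η := η)
    (κ := ProbabilityTheory.Kernel.const Unit m) (a := ()) (f := f)
    (Integrable.of_bound hf.aestronglyMeasurable C (ae_of_all _ hC))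
  rwa [ProbabilityTheory.Kernel.comp_apply, ProbabilityTheory.Kernel.const_apply] at h

theorem isProbabilityMeasure_bind {α β : Type*} [MeasurableSpace α] [MeasurableSpace β]
    {m : Measure α} [IsProbabilityMeasure m] {κ : α → Measure β} (hκ : Measurable κ)
    (hp : ∀ a, IsProbabilityMeasure (κ a)) : IsProbabilityMeasure (m.bind κ) :=
  ⟨by simp [Measure.bind_apply MeasurableSet.univ hκ.aemeasurable]⟩

/-- A hitting-time estimate: if from every point of `D` the kernel `U` charges `B` with mass at
least `α`, and `G` is small on `B` and almost subharmonic for `U`, then the integral of `G`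
against a measure whose iterates essentially live on `D` is small. -/
theorem integral_le_of_hitting {X : Type*} [MeasurableSpace X] {U : X → Measure X}
    (hU : Measurable U) (hUp : ∀ x, IsProbabilityMeasure (U x))
    {G : X → ℝ} (hG : Measurable G) {C : ℝ} (hG0 : ∀ x, 0 ≤ G x) (hGC : ∀ x, G x ≤ C)
    {B D : Set X} (hB : MeasurableSet B) (hD : MeasurableSet D)
    {α η c ε : ℝ} (hα0 : 0 ≤ α) (hα1 : α ≤ 1) (hc : 0 ≤ c) (hC : 0 ≤ C) (hε : 0 ≤ ε) (hη : 0 ≤ η)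
    (hUB : ∀ y ∈ D, α ≤ (U y).real B) (hGB : ∀ y ∈ B, G y ≤ η)
    (hGU : ∀ y, G y ≤ ∫ w, G w ∂(U y) + c)
    {Good : Measure X → Prop} (hGood_bind : ∀ ρ, Good ρ → Good (ρ.bind U))
    (hGood_mono : ∀ ρ ρ', ρ' ≤ ρ → Good ρ → Good ρ')
    (hGood : ∀ ρ : Measure X, Good ρ → ρ Dᶜ ≤ ENNReal.ofReal ε) (k : ℕ) :
    ∀ (ρ : Measure X) [IsFiniteMeasure ρ], Good ρ →
      ∫ x, G x ∂ρ ≤ (η + k * c) * ρ.real univ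
        + C * ((1 - α) ^ k * ρ.real univ + ε * (1 - (1 - α) ^ k)) := by
  have hGabs : ∀ x, |G x| ≤ C := fun x => by rw [abs_of_nonneg (hG0 x)]; exact hGC x
  have hGint : ∀ (ρ : Measure X) [IsFiniteMeasure ρ], Integrable G ρ := fun ρ _ =>
    Integrable.of_bound hG.aestronglyMeasurable C (ae_of_all _ (show ∀ x, ‖G x‖ ≤ C from hGabs))
  induction k with
  | zero =>
    intro ρ _ hρ
    have h1 : ∫ x, G x ∂ρ ≤ ∫ _, C ∂ρ := integral_mono (hGint ρ) (integrable_const _) hGC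
    simp only [integral_const, smul_eq_mul] at h1
    have h2 : 0 ≤ η * ρ.real univ := by positivity
    simp
    linarith
  | succ k ih =>
    intro ρ _ hρ
    have hbu : ∀ A, MeasurableSet A → (ρ.bind U) A = ∫⁻ y, U y A ∂ρ := fun A hA =>
      Measure.bind_apply hA hU.aemeasurable
    have hmass : (ρ.bind U) univ = ρ univ := by rw [hbu _ MeasurableSet.univ]; simp
    have : IsFiniteMeasure (ρ.bind U) := ⟨by rw [hmass]; exact measure_lt_top _ _⟩
    set ρ' := (ρ.bind U).restrict Bᶜ with hρ'
    have hgood' : Good ρ' := hGood_mono _ _ Measure.restrict_le_self (hGood_bind _ hρ)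
    have hih := ih ρ' hgood'
    have h1 : ∫ x, G x ∂ρ ≤ ∫ x, G x ∂(ρ.bind U) + c * ρ.real univ := by
      rw [integral_bind_of_bounded hU hUp hG hGabs]
      have hi : Integrable (fun y => ∫ w, G w ∂(U y)) ρ := by
        refine Integrable.of_bound (C := C) ?_ (ae_of_all _ fun y => ?_)
        · let κ : ProbabilityTheory.Kernel X X := ⟨U, hU⟩
          exact (hG.stronglyMeasurable.integral_kernel (κ := κ)).aestronglyMeasurable
        · have := norm_integral_le_of_norm_le_const (μ := U y)
            (ae_of_all _ (show ∀ x, ‖G x‖ ≤ C from hGabs))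
          simpa using this
      calc ∫ x, G x ∂ρ ≤ ∫ y, (∫ w, G w ∂(U y) + c) ∂ρ :=
            integral_mono (hGint ρ) (hi.add (integrable_const c)) hGU
        _ = _ := by
            rw [integral_add hi (integrable_const c)]
            simp [mul_comm]
    have h2 : ∫ x, G x ∂(ρ.bind U) = ∫ x in B, G x ∂(ρ.bind U) + ∫ x, G x ∂ρ' :=
      (integral_add_compl hB (hGint _)).symm
    have h3 : ∫ x in B, G x ∂(ρ.bind U) ≤ η * (ρ.bind U).real B := by
      have := setIntegral_mono_on (μ := ρ.bind U) (s := B) (hGint _).integrableOn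
        (integrable_const η).integrableOn hB hGB
      simpa [mul_comm] using this
    have h4 : ρ'.real univ = ρ.real univ - (ρ.bind U).real B := by
      have e : ρ'.real univ = (ρ.bind U).real Bᶜ := by simp [hρ', measureReal_def]
      rw [e, measureReal_compl hB]; simp only [measureReal_def, hmass]
    have h5 : α * ρ.real D ≤ (ρ.bind U).real B := by
      have : ENNReal.ofReal α * ρ D ≤ (ρ.bind U) B := by
        rw [hbu B hB]
        calc ENNReal.ofReal α * ρ D = ∫⁻ _ in D, ENNReal.ofReal α ∂ρ := by simp
          _ ≤ ∫⁻ y in D, U y B ∂ρ := by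
              refine setLIntegral_mono' hD fun y hy => ?_
              rw [ENNReal.ofReal_le_iff_le_toReal (measure_ne_top _ _)]
              exact hUB y hy
          _ ≤ _ := setLIntegral_le_lintegral _ _
      have := ENNReal.toReal_mono (measure_ne_top _ _) this
      rwa [ENNReal.toReal_mul, ENNReal.toReal_ofReal hα0] at this
    have h6 : ρ.real univ - ε ≤ ρ.real D := by
      have := ENNReal.toReal_mono ENNReal.ofReal_ne_top (hGood ρ hρ)
      rw [ENNReal.toReal_ofReal hε] at this
      have e := measureReal_compl (μ := ρ) hD
      rw [measureReal_def] at e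
      linarith
    set p := ρ'.real univ
    set r := ρ.real univ
    set b := (ρ.bind U).real B
    have hb : 0 ≤ b := measureReal_nonneg
    have hp : p ≤ (1 - α) * r + α * ε := by
      have := mul_le_mul_of_nonneg_left h6 hα0
      linarith
    have hq : 0 ≤ C * (1 - α) ^ k := mul_nonneg hC (pow_nonneg (by linarith) _)
    have h7 := mul_le_mul_of_nonneg_left hp hq
    have h8 : k * c * p ≤ k * c * r := mul_le_mul_of_nonneg_left (by linarith) (by positivity)
    have h9 : p = r - b := h4
    push_cast
    rw [pow_succ]
    have h10 : η * p = η * r - η * b := by rw [h9]; ring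
    linarith

section GlidingHump

variable {X : Type*} [MetricSpace X]

/-- The union of the members of the family `C` selected by `a`. -/
def selectedUnion (C : ℕ → Set X) (a : ℕ → Bool) : Set X := ⋃ i, ⋃ _ : a i = true, C i

theorem thickenedIndicator_selectedUnion {C : ℕ → Set X} {δ : ℝ} (hδ : 0 < δ) {x : X} {j : ℕ}
    (hx : ∀ i, i ≠ j → x ∉ thickening δ (C i)) (a : ℕ → Bool) :
    thickenedIndicator hδ (selectedUnion C a) x =
      if a j then thickenedIndicator hδ (C j) x else 0 := by
  split_ifs with haj
  · apply le_antisymm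
    · set R : Set X := ⋃ i, ⋃ _ : i ≠ j, C i
      have hsub : selectedUnion C a ⊆ C j ∪ R := by
        intro y hy
        simp only [selectedUnion, mem_iUnion] at hy
        obtain ⟨i, -, hi⟩ := hy
        by_cases h : i = j
        · exact Or.inl (h ▸ hi)
        · exact Or.inr (mem_iUnion₂.2 ⟨i, h, hi⟩)
      have hR : ENNReal.ofReal δ ≤ infEDist x R := by
        have : x ∉ thickening δ R := by
          simp only [R, thickening_iUnion, mem_iUnion, not_exists]
          exact fun i hi => hx i hi
        simpa [thickening] using this
      refine (thickenedIndicator_subset hδ hsub x).trans ?_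
      rcases le_total (infEDist x (C j)) (infEDist x R) with h | h
      · apply le_of_eq
        simp only [thickenedIndicator_apply, thickenedIndicatorAux, infEDist_union,
          inf_eq_left.2 h]
      · refine (thickenedIndicator_zero hδ _ ?_).trans_le zero_le
        · rw [thickening, mem_ofPred_eq, infEDist_union, not_lt]
          exact le_inf (hR.trans h) hR
    · have hsub : C j ⊆ selectedUnion C a := fun y hy => mem_iUnion₂.2 ⟨j, haj, hy⟩
      exact thickenedIndicator_subset hδ hsub x
  · refine thickenedIndicator_zero hδ _ ?_
    simp only [selectedUnion, thickening_iUnion, mem_iUnion, not_exists]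
    rintro i hi
    exact hx i (by rintro rfl; exact haj hi)

/-- If a sequence of probability measures converges when tested against indicators of thickenings
of unions of separated sets, it cannot put mass at least `ε` on the sets of the family. -/
theorem exists_measureReal_le_of_separated [MeasurableSpace X] [OpensMeasurableSpace X]
    {ν : ℕ → Measure X}
    (hν : ∀ n, IsProbabilityMeasure (ν n)) {C : ℕ → Set X} (hC : ∀ i, MeasurableSet (C i))
    {δ : ℝ} (hδ : 0 < δ)
    (hsep : ∀ x i j, x ∈ thickening δ (C i) → x ∈ thickening δ (C j) → i = j)
    (hconv : ∀ E : Set X, ∃ l, Tendsto (fun n => ∫ x, (thickenedIndicator hδ E x : ℝ) ∂(ν n))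
      atTop (𝓝 l))
    {ε : ℝ} (hε : 0 < ε) : ∃ j, (ν j).real (C j) ≤ ε := by
  by_contra! hcon
  have hj : ∀ x, ∃ j, ∀ i, i ≠ j → x ∉ thickening δ (C i) := by
    intro x
    by_cases h : ∃ j, x ∈ thickening δ (C j)
    · obtain ⟨j, hj⟩ := h
      exact ⟨j, fun i hij hi => hij (hsep x i j hi hj)⟩
    · push Not at h
      exact ⟨0, fun i _ => h i⟩
  have hint : ∀ (E : Set X) n, Integrable (fun x => (thickenedIndicator hδ E x : ℝ)) (ν n) := by
    intro E n
    refine Integrable.of_bound (C := 1) ?_ (ae_of_all _ fun x => ?_)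
    · exact (NNReal.continuous_coe.comp (thickenedIndicator hδ E).continuous).aestronglyMeasurable
    · simpa using thickenedIndicator_le_one hδ E x
  let F : ℕ → (ℕ → Bool) → ℝ := fun n a =>
    ∫ x, (thickenedIndicator hδ (selectedUnion C a) x : ℝ) ∂(ν n)
  have hFcont : ∀ n, Continuous (F n) := by
    intro n
    refine continuous_of_dominated (bound := fun _ => 1) (fun a => (hint _ n).1) (fun a => ?_)
      (integrable_const _) ?_
    · exact ae_of_all _ fun x => by simpa using thickenedIndicator_le_one hδ _ x
    · refine ae_of_all _ fun x => ?_
      obtain ⟨j, hx⟩ := hj x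
      simp_rw [thickenedIndicator_selectedUnion hδ hx]
      exact (continuous_of_discreteTopology (f := fun b : Bool =>
        (((if b then thickenedIndicator hδ (C j) x else 0 : NNReal)) : ℝ))).comp
        (continuous_apply j)
  let E : ℕ → Set (ℕ → Bool) := fun N => ⋂ i ≥ N, ⋂ k ≥ N, {a | |F i a - F k a| ≤ ε / 4}
  have hEclosed : ∀ N, IsClosed (E N) := fun N =>
    isClosed_biInter fun i _ => isClosed_biInter fun k _ =>
      isClosed_le ((hFcont i).sub (hFcont k)).abs continuous_const
  have hEunion : ⋃ N, E N = univ := by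
    refine eq_univ_of_forall fun a => ?_
    obtain ⟨l, hl⟩ := hconv (selectedUnion C a)
    obtain ⟨N, hN⟩ := Metric.cauchySeq_iff.1 hl.cauchySeq (ε / 4) (by positivity)
    simp only [E, mem_iUnion, mem_iInter, mem_ofPred_eq]
    exact ⟨N, fun i hi k hk => (hN i hi k hk).le⟩
  obtain ⟨N, a, ha⟩ := nonempty_interior_of_iUnion_of_closed hEclosed hEunion
  obtain ⟨I, u, hu, hIu⟩ := isOpen_pi_iff.1 isOpen_interior a ha
  have hupd : ∀ j ∉ I, ∀ b, Function.update a j b ∈ E N := by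
    intro j hjI b
    refine interior_subset (hIu fun i hi => ?_)
    rw [Function.update_of_ne (by rintro rfl; exact hjI hi)]
    exact (hu i hi).2
  let m : ℕ → ℕ → ℝ := fun n j => ∫ x, (thickenedIndicator hδ (C j) x : ℝ) ∂(ν n)
  have hm : ∀ n j, m n j = F n (Function.update a j true) - F n (Function.update a j false) := by
    intro n j
    simp only [m, F]
    rw [← integral_sub (hint _ n) (hint _ n)]
    refine integral_congr_ae (ae_of_all _ fun x => ?_)
    obtain ⟨i, hx⟩ := hj x
    simp only [thickenedIndicator_selectedUnion hδ hx]
    by_cases hij : j = i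
    · subst hij; simp
    · simp [Function.update_of_ne (Ne.symm hij), thickenedIndicator_zero hδ _ (hx j hij)]
  have hclose : ∀ j ∉ I, ∀ i ≥ N, |m i j - m N j| ≤ ε / 2 := by
    intro j hjI i hi
    have h1 := hupd j hjI true
    have h2 := hupd j hjI false
    simp only [E, mem_iInter, mem_ofPred_eq] at h1 h2
    have h1 := abs_le.1 (h1 i hi N le_rfl)
    have h2 := abs_le.1 (h2 i hi N le_rfl)
    rw [hm, hm, abs_le]
    constructor <;> linarith
  have hlim : Tendsto (m N) atTop (𝓝 0) := by
    have := tendsto_integral_of_dominated_convergence (μ := ν N) (f := fun _ => (0 : ℝ))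
      (F := fun j x => (thickenedIndicator hδ (C j) x : ℝ)) (fun _ => 1)
      (fun j => (hint _ N).1) (integrable_const _)
      (fun j => ae_of_all _ fun x => by simpa using thickenedIndicator_le_one hδ _ x)
      (ae_of_all _ fun x => by
        obtain ⟨i, hx⟩ := hj x
        refine tendsto_const_nhds.congr' ?_
        filter_upwards [eventually_gt_atTop i] with j hji
        simp [thickenedIndicator_zero hδ _ (hx j hji.ne')])
    rwa [integral_zero] at this
  have hI : ∀ᶠ j in atTop, j ∉ I := by
    filter_upwards [eventually_gt_atTop (I.sup id)] with j hj' hjI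
    exact absurd (Finset.le_sup (f := id) hjI) (not_le.2 hj')
  obtain ⟨j, hjI, hjN, hjm⟩ := (hI.and ((eventually_ge_atTop N).and
    (hlim.eventually (gt_mem_nhds (show (0 : ℝ) < ε / 2 by positivity))))).exists
  have h1 : (ν j).real (C j) ≤ m j j := by
    rw [← integral_indicator_one (hC j)]
    refine integral_mono ((integrable_const (1 : ℝ)).indicator (hC j)) (hint _ j) fun x => ?_
    by_cases hx : x ∈ C j
    · simp [hx, thickenedIndicator_one hδ _ hx]
    · simp [hx]
  have h2 := (abs_le.1 (hclose j hjI j hjN)).2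
  linarith [hcon j]

end GlidingHump

section Tightness

theorem isBddLipschitz_thickenedIndicator {X : Type*} [MetricSpace X] {δ : ℝ} (hδ : 0 < δ)
    (E : Set X) :
    IsBddLipschitz fun x => (thickenedIndicator hδ E x : ℝ) :=
  ⟨⟨_, fun x y => lipschitzWith_thickenedIndicator hδ E x y⟩, 1,
    fun x => by simpa using thickenedIndicator_le_one hδ E x⟩

variable {X : Type*} [MeasurableSpace X] [MetricSpace X] [BorelSpace X] [CompleteSpace X]
  [SecondCountableTopology X]

theorem exists_isCompact_eventually_measure_compl_thickening_le {μ : ℕ → Measure X}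
    (hμ : ∀ n, IsProbabilityMeasure (μ n))
    (h : ∀ ψ : X → ℝ, IsBddLipschitz ψ → ∃ l, Tendsto (fun n => ∫ x, ψ x ∂(μ n)) atTop (𝓝 l))
    {r : ℝ} (hr : 0 < r) {ε : ℝ} (hε : 0 < ε) :
    ∃ C : Set X, IsCompact C ∧ ∃ N, ∀ n ≥ N, μ n (thickening r C)ᶜ ≤ ENNReal.ofReal ε := by
  by_contra! hcon
  obtain ⟨f, hf, hfr⟩ := exists_seq_of_forall_finset_exists
    (fun p : Set X × ℕ => IsCompact p.1 ∧ ENNReal.ofReal ε < μ p.2 p.1)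
    (fun p q => p.2 < q.2 ∧ q.1 ⊆ (thickening r p.1)ᶜ) (fun s hs => by
      obtain ⟨n, hn, hlt⟩ := hcon (⋃ p ∈ s, p.1)
        (s.isCompact_biUnion fun p hp => (hs p hp).1) (s.sup Prod.snd + 1)
      obtain ⟨K, hKsub, hK, hKlt⟩ := innerRegular_isCompact_isClosed_measurableSet_of_finite
        (μ n) isOpen_thickening.isClosed_compl.measurableSet _ hlt
      refine ⟨(K, n), ⟨hK.1, hKlt⟩, fun p hp => ⟨?_, hKsub.trans (compl_subset_compl.2 ?_)⟩⟩
      · exact lt_of_le_of_lt (Finset.le_sup (f := Prod.snd) hp) hn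
      · exact thickening_subset_of_subset _ (subset_biUnion_of_mem (u := Prod.fst) hp))
  have hmono : StrictMono fun i => (f i).2 := fun i j hij => (hfr i j hij).1
  have hsep : ∀ x i j, i < j → x ∈ thickening (r / 2) (f i).1 →
      x ∉ thickening (r / 2) (f j).1 := by
    intro x i j hij hi hj
    obtain ⟨y, hy, hxy⟩ := mem_thickening_iff.1 hi
    obtain ⟨w, hw, hxw⟩ := mem_thickening_iff.1 hj
    refine (hfr i j hij).2 hw (mem_thickening_iff.2 ⟨y, hy, ?_⟩)
    have := dist_triangle_left w y x
    linarith
  obtain ⟨j, hj⟩ := exists_measureReal_le_of_separated (fun n => hμ (f n).2)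
    (fun i => (hf i).1.measurableSet) (half_pos hr)
    (fun x i j hi hj => by
      rcases lt_trichotomy i j with hij | hij | hij
      · exact absurd hj (hsep x i j hij hi)
      · exact hij
      · exact absurd hi (hsep x j i hij hj))
    (fun E => by
      obtain ⟨l, hl⟩ := h _ (isBddLipschitz_thickenedIndicator (half_pos hr) E)
      exact ⟨l, hl.comp hmono.tendsto_atTop⟩) hε
  have := (ENNReal.ofReal_lt_iff_lt_toReal hε.le (measure_ne_top _ _)).1 (hf j).2
  exact absurd hj (not_le.2 this)

/-- A sequence of Borel probability measures on a complete separable metric space whose integrals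
of bounded Lipschitz functions all converge is tight. -/
theorem isTightMeasureSet_range_of_forall_lipschitz_tendsto {μ : ℕ → Measure X}
    (hμ : ∀ n, IsProbabilityMeasure (μ n))
    (h : ∀ ψ : X → ℝ, IsBddLipschitz ψ → ∃ l, Tendsto (fun n => ∫ x, ψ x ∂(μ n)) atTop (𝓝 l)) :
    IsTightMeasureSet (range μ) := by
  have hcov : ∀ r : ℝ, 0 < r → ∀ ε : ENNReal, 0 < ε →
      ∃ C : Set X, IsCompact C ∧ ∀ n, μ n (thickening r C)ᶜ ≤ ε := by
    intro r hr ε hε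
    obtain ⟨δ, hδ, hδε⟩ : ∃ δ : ℝ, 0 < δ ∧ ENNReal.ofReal δ ≤ ε := by
      obtain ⟨δ, h1, h2⟩ := ENNReal.lt_iff_exists_nnreal_btwn.1 hε
      exact ⟨δ, by simpa using h1, by simpa using h2.le⟩
    obtain ⟨C, hC, N, hN⟩ :=
      exists_isCompact_eventually_measure_compl_thickening_le hμ h hr hδ
    have hK : ∀ n, ∃ K : Set X, IsCompact K ∧ μ n Kᶜ ≤ ε := fun n => by
      obtain ⟨K, hK, hKε⟩ := isTightMeasureSet_iff_exists_isCompact_measure_compl_le.1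
        (isTightMeasureSet_singleton (μ := μ n)) ε hε
      exact ⟨K, hK, hKε _ rfl⟩
    choose K hKc hKε using hK
    refine ⟨C ∪ ⋃ n ∈ Finset.range N, K n,
      hC.union ((Finset.range N).isCompact_biUnion fun n _ => hKc n), fun n => ?_⟩
    rcases lt_or_ge n N with hn | hn
    · refine (measure_mono (compl_subset_compl.2 ?_)).trans (hKε n)
      refine Subset.trans ?_ (self_subset_thickening hr _)
      exact subset_union_of_subset_right
        (subset_biUnion_of_mem (u := K) (Finset.mem_coe.2 (Finset.mem_range.2 hn))) _
    · refine (measure_mono (compl_subset_compl.2 ?_)).trans ((hN n hn).trans hδε)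
      exact thickening_subset_of_subset _ subset_union_left
  rw [isTightMeasureSet_iff_exists_isCompact_measure_compl_le]
  intro ε hε
  obtain ⟨e, he, hesum⟩ := ENNReal.exists_pos_sum_of_countable' hε.ne' ℕ
  choose C hC hCμ using fun m : ℕ => hcov (1 / ((m : ℝ) + 1)) (by positivity) (e m) (he m)
  refine ⟨⋂ m : ℕ, cthickening (1 / ((m : ℝ) + 1)) (C m), ?_, ?_⟩
  · refine TotallyBounded.isCompact_of_isClosed ?_ (isClosed_iInter fun m => isClosed_cthickening)
    refine Metric.totallyBounded_iff.2 fun δ hδ => ?_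
    obtain ⟨m, hm⟩ := exists_nat_one_div_lt (half_pos hδ)
    obtain ⟨t, ht, htC⟩ := Metric.totallyBounded_iff.1 (hC m).totallyBounded (δ / 2) (half_pos hδ)
    refine ⟨t, ht, fun x hx => ?_⟩
    have hx := cthickening_subset_thickening' (half_pos hδ) hm _ (mem_iInter.1 hx m)
    obtain ⟨y, hy, hxy⟩ := mem_thickening_iff.1 hx
    obtain ⟨w, hw, hyw⟩ := mem_iUnion₂.1 (htC hy)
    refine mem_iUnion₂.2 ⟨w, hw, ?_⟩
    have := dist_triangle x y w
    rw [mem_ball] at hyw ⊢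
    linarith
  · rintro _ ⟨n, rfl⟩
    rw [compl_iInter]
    calc _ ≤ ∑' m : ℕ, μ n (cthickening (1 / ((m : ℝ) + 1)) (C m))ᶜ := measure_iUnion_le _
      _ ≤ ∑' m : ℕ, e m := ENNReal.tsum_le_tsum fun m =>
          (measure_mono (compl_subset_compl.2 (thickening_subset_cthickening _ _))).trans (hCμ m n)
      _ ≤ ε := hesum.le

/-- Weak sequential completeness of the set of Borel probability measures. -/
theorem exists_probabilityMeasure_of_forall_lipschitz_tendsto {μ : ℕ → Measure X}
    (hμ : ∀ n, IsProbabilityMeasure (μ n))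
    (h : ∀ ψ : X → ℝ, IsBddLipschitz ψ → ∃ l, Tendsto (fun n => ∫ x, ψ x ∂(μ n)) atTop (𝓝 l)) :
    ∃ ν : ProbabilityMeasure X, ∀ ψ : X → ℝ, IsBddLipschitz ψ →
      Tendsto (fun n => ∫ x, ψ x ∂(μ n)) atTop (𝓝 (∫ x, ψ x ∂(ν : Measure X))) := by
  let p : ℕ → ProbabilityMeasure X := fun n => ⟨μ n, hμ n⟩
  have ht : IsTightMeasureSet {((q : ProbabilityMeasure X) : Measure X) | q ∈ range p} := by
    refine (isTightMeasureSet_range_of_forall_lipschitz_tendsto hμ h).subset ?_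
    rintro _ ⟨_, ⟨n, rfl⟩, rfl⟩
    exact ⟨n, rfl⟩
  obtain ⟨ν, -, φ, hφ, hlim⟩ := (isCompact_closure_of_isTightMeasureSet ht).isSeqCompact
    (x := p) (fun n => subset_closure ⟨n, rfl⟩)
  refine ⟨ν, fun ψ hψ => ?_⟩
  obtain ⟨l, hl⟩ := h ψ hψ
  obtain ⟨⟨L, hL⟩, C, hC⟩ := hψ
  have h1 := tendsto_iff_forall_lipschitz_integral_tendsto.1 hlim ψ
    ⟨C + C, fun x y => by
      rw [Real.dist_eq]; exact (abs_sub _ _).trans (add_le_add (hC x) (hC y))⟩ ⟨L, hL⟩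
  rwa [← tendsto_nhds_unique (hl.comp hφ.tendsto_atTop) h1]

end Tightness

section TimeAverages

/-- Average of `g` over `[0, S]`. -/
def timeAvg (g : ℝ → ℝ) (S : ℝ) : ℝ := S⁻¹ * ∫ r in 0..S, g r

variable {g : ℝ → ℝ} {C : ℝ}

theorem intervalIntegrable_of_bounded (hg : Measurable g) (hC : ∀ r, |g r| ≤ C) (a b : ℝ) :
    IntervalIntegrable g volume a b := by
  have : IsFiniteMeasure (volume.restrict (uIoc a b)) := ⟨by simp [uIoc]⟩
  rw [intervalIntegrable_iff]
  exact Integrable.of_bound hg.aestronglyMeasurable C (ae_of_all _ hC)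

theorem abs_timeAvg_le {S : ℝ} (hS : 0 < S) (hC : ∀ r, 0 ≤ r → |g r| ≤ C) :
    |timeAvg g S| ≤ C := by
  have h := intervalIntegral.norm_integral_le_of_norm_le_const (a := 0) (b := S) (f := g) (C := C)
    (fun r hr => by
      rw [uIoc_of_le hS.le] at hr
      exact hC r hr.1.le)
  rw [sub_zero, abs_of_pos hS, Real.norm_eq_abs] at h
  rw [timeAvg, abs_mul, abs_of_pos (inv_pos.2 hS), inv_mul_le_iff₀ hS, mul_comm]
  exact h

theorem timeAvg_sub_const {S : ℝ} (hS : 0 < S) (hg : IntervalIntegrable g volume 0 S) (c : ℝ) :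
    timeAvg g S - c = timeAvg (fun r => g r - c) S := by
  rw [timeAvg, timeAvg, intervalIntegral.integral_sub hg (by simp),
    intervalIntegral.integral_const]
  simp
  field_simp

theorem timeAvg_sub {f : ℝ → ℝ} {S : ℝ} (hf : IntervalIntegrable f volume 0 S)
    (hg : IntervalIntegrable g volume 0 S) :
    timeAvg f S - timeAvg g S = timeAvg (fun r => f r - g r) S := by
  rw [timeAvg, timeAvg, timeAvg, intervalIntegral.integral_sub hf hg, mul_sub]

theorem abs_timeAvg_shift_sub_le (hg : Measurable g) (hC : ∀ r, |g r| ≤ C) {a S : ℝ}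
    (ha : 0 ≤ a) (hS : 0 < S) :
    |timeAvg (fun r => g (a + r)) S - timeAvg g S| ≤ 2 * C * a / S := by
  have hi := intervalIntegrable_of_bounded hg hC
  have hb : ∀ u v : ℝ, |∫ r in u..v, g r| ≤ C * |v - u| := fun u v => by
    have := intervalIntegral.norm_integral_le_of_norm_le_const (a := u) (b := v) (f := g) (C := C)
      (fun r _ => hC r)
    rwa [Real.norm_eq_abs] at this
  have h1 : ∫ r in 0..S, g (a + r) = ∫ r in a..(a + S), g r := by
    rw [intervalIntegral.integral_comp_add_left g a, add_zero]
  have h2 : (∫ r in a..(a + S), g r) - ∫ r in 0..S, g r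
      = (∫ r in S..(a + S), g r) - ∫ r in 0..a, g r := by
    have e1 := intervalIntegral.integral_add_adjacent_intervals (hi 0 a) (hi a (a + S))
    have e2 := intervalIntegral.integral_add_adjacent_intervals (hi 0 S) (hi S (a + S))
    linarith
  have h3 := hb S (a + S)
  have h4 := hb 0 a
  rw [add_sub_cancel_right, abs_of_nonneg ha] at h3
  rw [sub_zero, abs_of_nonneg ha] at h4
  rw [timeAvg, timeAvg, ← mul_sub, h1, h2, abs_mul, abs_of_pos (inv_pos.2 hS),
    inv_mul_eq_div, div_le_div_iff_of_pos_right hS]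
  exact (abs_sub _ _).trans (by linarith)

theorem measurable_timeAvg_add (hg : Measurable g) {T : ℝ} (hT : 0 < T) :
    Measurable fun r => timeAvg (fun t => g (r + t)) T := by
  have hadd : Measurable fun p : ℝ × ℝ => g (p.1 + p.2) := hg.comp measurable_add
  simp only [timeAvg, intervalIntegral.integral_of_le hT.le]
  exact (hadd.stronglyMeasurable.integral_prod_right.measurable).const_mul _

theorem abs_timeAvg_timeAvg_sub_le (hg : Measurable g) (hC : ∀ r, |g r| ≤ C) {S T : ℝ}
    (hS : 0 < S) (hT : 0 < T) :
    |timeAvg (fun t => timeAvg (fun r => g (t + r)) S) T - timeAvg g T| ≤ 2 * C * S / T := by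
  have hC0 : 0 ≤ C := (abs_nonneg _).trans (hC 0)
  have hadd : Measurable fun p : ℝ × ℝ => g (p.1 + p.2) := hg.comp measurable_add
  have hswap : timeAvg (fun t => timeAvg (fun r => g (t + r)) S) T
      = timeAvg (fun r => timeAvg (fun t => g (r + t)) T) S := by
    simp only [timeAvg, intervalIntegral.integral_const_mul]
    have : ∫ t in 0..T, ∫ r in 0..S, g (t + r) = ∫ r in 0..S, ∫ t in 0..T, g (r + t) := by
      simp only [intervalIntegral.integral_of_le hS.le, intervalIntegral.integral_of_le hT.le]
      rw [integral_integral_swap (f := fun t r => g (t + r))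
        (Integrable.of_bound hadd.aestronglyMeasurable C (ae_of_all _ fun p => hC _))]
      simp only [add_comm]
    rw [this]
    ring
  rw [hswap, timeAvg_sub_const hS (intervalIntegrable_of_bounded (measurable_timeAvg_add hg hT)
    (fun r => abs_timeAvg_le hT fun t _ => hC (r + t)) 0 S)]
  -- on `[0, S]` the shift estimate applies with `a = r ≤ S`
  have hpt : ∀ r ∈ Icc 0 S, |timeAvg (fun t => g (r + t)) T - timeAvg g T| ≤ 2 * C * S / T := by
    intro r hr
    refine (abs_timeAvg_shift_sub_le hg hC hr.1 hT).trans ?_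
    gcongr
    exact hr.2
  have h := intervalIntegral.norm_integral_le_of_norm_le_const (a := 0) (b := S)
    (f := fun r => timeAvg (fun t => g (r + t)) T - timeAvg g T) (C := 2 * C * S / T)
    (fun r hr => by
      rw [uIoc_of_le hS.le] at hr
      exact hpt r ⟨hr.1.le, hr.2⟩)
  rw [sub_zero, abs_of_pos hS, Real.norm_eq_abs] at h
  rw [timeAvg, abs_mul, abs_of_pos (inv_pos.2 hS), inv_mul_le_iff₀ hS, mul_comm]
  exact h

end TimeAverages

namespace MarkovSemigroup

section

variable {X : Type*} [MeasurableSpace X] (M : MarkovSemigroup X)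

instance (t : ℝ) (x : X) : IsProbabilityMeasure (M.P t x) := M.prob t x

theorem measurable_P (t : ℝ) : Measurable (M.P t) :=
  M.meas.comp (measurable_const.prodMk measurable_id)

theorem measurable_act {ψ : X → ℝ} (hψ : Measurable ψ) :
    Measurable fun p : ℝ × X => M.act p.1 ψ p.2 := by
  let κ : ProbabilityTheory.Kernel (ℝ × X) X := ⟨fun p => M.P p.1 p.2, M.meas⟩
  exact (hψ.stronglyMeasurable.integral_kernel (κ := κ)).measurable

theorem abs_act_le {ψ : X → ℝ} {C : ℝ} (hC : ∀ x, |ψ x| ≤ C) (t : ℝ) (x : X) :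
    |M.act t ψ x| ≤ C := by
  have := norm_integral_le_of_norm_le_const (μ := M.P t x)
    (ae_of_all _ (show ∀ x, ‖ψ x‖ ≤ C from hC))
  simpa [act] using this

theorem act_add {ψ : X → ℝ} (hψ : Measurable ψ) {C : ℝ} (hC : ∀ x, |ψ x| ≤ C) {t s : ℝ}
    (ht : 0 ≤ t) (hs : 0 ≤ s) (x : X) :
    M.act (t + s) ψ x = ∫ y, M.act s ψ y ∂(M.P t x) := by
  rw [act, M.semigroup t s ht hs, integral_bind_of_bounded (M.measurable_P s) (M.prob s) hψ hC]
  rfl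

/-- The average of `P_r ψ (x)` over `r ∈ [0, S]`. -/
def avg (ψ : X → ℝ) (S : ℝ) (x : X) : ℝ := timeAvg (fun r => M.act r ψ x) S

theorem measurable_act_time {ψ : X → ℝ} (hψ : Measurable ψ) (x : X) :
    Measurable fun r => M.act r ψ x :=
  (M.measurable_act hψ).comp (measurable_id.prodMk measurable_const)

theorem measurable_avg {ψ : X → ℝ} (hψ : Measurable ψ) {S : ℝ} (hS : 0 < S) :
    Measurable (M.avg ψ S) := by
  unfold avg
  simp only [timeAvg, intervalIntegral.integral_of_le hS.le]
  have h : StronglyMeasurable (Function.uncurry fun (y : X) (r : ℝ) => M.act r ψ y) :=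
    ((M.measurable_act hψ).comp measurable_swap).stronglyMeasurable
  exact h.integral_prod_right.measurable.const_mul _

theorem abs_avg_le {ψ : X → ℝ} {C : ℝ} (hC : ∀ x, |ψ x| ≤ C) {S : ℝ} (hS : 0 < S) (x : X) :
    |M.avg ψ S x| ≤ C :=
  abs_timeAvg_le hS fun r _ => M.abs_act_le hC r x

theorem integral_avg {ψ : X → ℝ} (hψ : Measurable ψ) {C : ℝ} (hC : ∀ x, |ψ x| ≤ C) {S : ℝ}
    (hS : 0 < S) {t : ℝ} (ht : 0 ≤ t) (x : X) :
    ∫ y, M.avg ψ S y ∂(M.P t x) = timeAvg (fun r => M.act (t + r) ψ x) S := by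
  simp only [avg, timeAvg, intervalIntegral.integral_of_le hS.le, integral_const_mul]
  rw [integral_integral_swap (f := fun y r => M.act r ψ y)
    (Integrable.of_bound ((M.measurable_act hψ).comp measurable_swap).aestronglyMeasurable C
      (ae_of_all _ fun p => M.abs_act_le hC _ _))]
  congr 1
  exact setIntegral_congr_fun measurableSet_Ioc fun r hr =>
    (M.act_add hψ hC ht hr.1.le x).symm

theorem measurable_dual (ν : Measure X) [SFinite ν] : Measurable fun s => M.dual s ν := by
  refine Measure.measurable_of_measurable_coe _ fun A hA => ?_
  have : (fun s => M.dual s ν A) = fun s => ∫⁻ x, M.P s x A ∂ν := by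
    ext s
    exact Measure.bind_apply hA (M.measurable_P s).aemeasurable
  rw [this]
  exact ((Measure.measurable_coe hA).comp M.meas).lintegral_prod_right'

theorem isProbabilityMeasure_dual (s : ℝ) (ν : Measure X) [IsProbabilityMeasure ν] :
    IsProbabilityMeasure (M.dual s ν) :=
  isProbabilityMeasure_bind (M.measurable_P s) (M.prob s)

theorem isProbabilityMeasure_smul_restrict_Ioc {T : ℝ} (hT : 0 < T) :
    IsProbabilityMeasure (ENNReal.ofReal (1 / T) • (volume.restrict (Ioc (0 : ℝ) T))) := by
  refine ⟨?_⟩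
  simp only [Measure.smul_apply, Measure.restrict_apply MeasurableSet.univ, univ_inter,
    Real.volume_Ioc, sub_zero, smul_eq_mul]
  rw [← ENNReal.ofReal_mul (by positivity)]
  simp [hT.ne']

theorem isProbabilityMeasure_QM {T : ℝ} (hT : 0 < T) (ν : Measure X) [IsProbabilityMeasure ν] :
    IsProbabilityMeasure (M.QM T ν) := by
  rw [QM, if_neg (not_le.2 hT)]
  have := isProbabilityMeasure_smul_restrict_Ioc hT
  exact isProbabilityMeasure_bind (M.measurable_dual ν) fun s => M.isProbabilityMeasure_dual s ν

theorem integral_QM {T : ℝ} (hT : 0 < T) (ν : Measure X) [IsProbabilityMeasure ν] {ψ : X → ℝ}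
    (hψ : Measurable ψ) {C : ℝ} (hC : ∀ x, |ψ x| ≤ C) :
    ∫ x, ψ x ∂(M.QM T ν) = ∫ x, M.avg ψ T x ∂ν := by
  rw [QM, if_neg (not_le.2 hT)]
  have := isProbabilityMeasure_smul_restrict_Ioc hT
  rw [integral_bind_of_bounded (M.measurable_dual ν)
    (fun s => M.isProbabilityMeasure_dual s ν) hψ hC, integral_smul_measure]
  simp only [avg, timeAvg, intervalIntegral.integral_of_le hT.le, integral_const_mul]
  rw [integral_integral_swap (f := fun y r => M.act r ψ y)
    (Integrable.of_bound ((M.measurable_act hψ).comp measurable_swap).aestronglyMeasurable C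
      (ae_of_all _ fun p => M.abs_act_le hC _ _)), ENNReal.toReal_ofReal (by positivity),
    one_div, smul_eq_mul]
  congr 1
  refine integral_congr_ae (ae_of_all _ fun s => ?_)
  exact integral_bind_of_bounded (M.measurable_P s) (M.prob s) hψ hC

theorem avg_eq_integral_QM_dirac {T : ℝ} (hT : 0 < T) (x : X) {ψ : X → ℝ}
    (hψ : Measurable ψ) {C : ℝ} (hC : ∀ x, |ψ x| ≤ C) :
    M.avg ψ T x = ∫ y, ψ y ∂(M.QM T (Measure.dirac x)) := by
  rw [M.integral_QM hT _ hψ hC, integral_dirac' _ _ (M.measurable_avg hψ hT).stronglyMeasurable]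

theorem Invariant.QM_eq {M : MarkovSemigroup X} {μ : Measure X} (h : M.Invariant μ) {T : ℝ}
    [IsProbabilityMeasure μ] (hT : 0 < T) : M.QM T μ = μ := by
  have := isProbabilityMeasure_smul_restrict_Ioc hT
  rw [QM, if_neg (not_le.2 hT)]
  ext A hA
  rw [Measure.bind_apply hA (M.measurable_dual μ).aemeasurable]
  have hcongr : ∀ᵐ s ∂(ENNReal.ofReal (1 / T) • (volume.restrict (Ioc (0 : ℝ) T))),
      M.dual s μ A = μ A :=
    Measure.ae_smul_measure ((ae_restrict_iff' measurableSet_Ioc).2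
      (ae_of_all _ fun s hs => by rw [h s hs.1.le])) _
  rw [lintegral_congr_ae hcongr, lintegral_const, measure_univ, mul_one]

end

section Mixing

variable {X : Type*} [MeasurableSpace X] {M : MarkovSemigroup X}

theorem measureReal_add_eq_integral {t s : ℝ} (ht : 0 ≤ t) (hs : 0 ≤ s) (x : X) {B : Set X}
    (hB : MeasurableSet B) :
    (M.P (t + s) x).real B = ∫ w, (M.P s w).real B ∂(M.P t x) := by
  have h := M.act_add (ψ := B.indicator fun _ => 1) (measurable_const.indicator hB) (C := 1)
    (fun w => by by_cases hw : w ∈ B <;> simp [hw]) ht hs x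
  simpa [act, integral_indicator hB] using h

section Metric

variable [MetricSpace X] [BorelSpace X]

theorem exists_forall_thickening_le_measureReal_ball (hFeller : M.Feller) {K : Set X}
    (hK : IsCompact K) {z : X}
    (hz : ∀ k ∈ K, ∃ t : ℝ, 0 ≤ t ∧ z ∈ msupport (M.P t k)) {δ : ℝ} (hδ : 0 < δ) :
    ∃ I : Finset ℝ, (∀ s ∈ I, 0 ≤ s) ∧ ∃ γ : ℝ, 0 < γ ∧ ∃ ε : ℝ, 0 < ε ∧
      ∀ w ∈ thickening ε K, ∃ s ∈ I, γ ≤ (M.P s w).real (ball z δ) := by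
  set φ : X → ℝ := fun w => max 0 (1 - dist w z / δ) with hφ
  have hφc : Continuous φ := by fun_prop
  have hφ0 : ∀ w, 0 ≤ φ w := fun w => le_max_left _ _
  have hφ1 : ∀ w, φ w ≤ 1 := fun w => max_le zero_le_one (by
    have : 0 ≤ dist w z / δ := by positivity
    linarith)
  have hφabs : ∀ w, |φ w| ≤ 1 := fun w => by rw [abs_of_nonneg (hφ0 w)]; exact hφ1 w
  have hφpos : ∀ w ∈ ball z δ, 0 < φ w := fun w hw => lt_max_of_lt_right (by
    rw [sub_pos, div_lt_one hδ]; exact hw)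
  have hφle : ∀ w, φ w ≤ (ball z δ).indicator (fun _ => (1 : ℝ)) w := fun w => by
    by_cases hw : w ∈ ball z δ
    · simpa [hw] using hφ1 w
    · have : 1 ≤ dist w z / δ := by rw [one_le_div hδ]; simpa using hw
      simp only [indicator, hw, if_false]
      exact max_le le_rfl (by linarith)
  have hφi : ∀ s x, Integrable φ (M.P s x) := fun s x =>
    Integrable.of_bound hφc.aestronglyMeasurable 1 (ae_of_all _ hφabs)
  have hball : ∀ s x, M.act s φ x ≤ (M.P s x).real (ball z δ) := fun s x => by
    have h := integral_mono (hφi s x)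
      ((integrable_const (1 : ℝ)).indicator (measurableSet_ball (x := z) (ε := δ))) hφle
    rw [integral_indicator measurableSet_ball] at h
    simpa [act] using h
  have hpos : ∀ k ∈ K, ∃ t : ℝ, 0 ≤ t ∧ 0 < M.act t φ k := fun k hk => by
    obtain ⟨t, ht, hzt⟩ := hz k hk
    refine ⟨t, ht, ?_⟩
    rw [act, integral_pos_iff_support_of_nonneg hφ0 (hφi t k)]
    exact (hzt _ isOpen_ball (mem_ball_self hδ)).trans_le
      (measure_mono fun w hw => (hφpos w hw).ne')
  choose! τ hτ0 hτ using hpos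
  have hcont : ∀ k ∈ K, Continuous (M.act (τ k) φ) := fun k hk =>
    hFeller _ (hτ0 k hk) _ ⟨hφc, 1, hφabs⟩
  obtain ⟨J, hJK, hJ⟩ := hK.elim_nhds_subcover
    (fun k => {w | M.act (τ k) φ k / 2 < M.act (τ k) φ w}) fun k hk =>
      (hcont k hk).continuousAt.eventually_const_lt (half_lt_self (hτ k hk))
  have hopen : IsOpen (⋃ k ∈ J, {w | M.act (τ k) φ k / 2 < M.act (τ k) φ w}) :=
    isOpen_biUnion fun k hk => isOpen_lt continuous_const (hcont k (hJK k hk))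
  obtain ⟨ε, hε, hεJ⟩ := hK.exists_thickening_subset_open hopen hJ
  classical
  obtain ⟨γ, hγ, hγJ⟩ : ∃ γ : ℝ, 0 < γ ∧ ∀ k ∈ J, γ ≤ M.act (τ k) φ k / 2 := by
    rcases J.eq_empty_or_nonempty with rfl | hne
    · exact ⟨1, one_pos, by simp⟩
    · exact ⟨J.inf' hne fun k => M.act (τ k) φ k / 2,
        (Finset.lt_inf'_iff _).2 fun k hk => half_pos (hτ k (hJK k hk)),
        fun k hk => Finset.inf'_le _ hk⟩
  refine ⟨J.image τ, ?_, γ, hγ, ε, hε, fun w hw => ?_⟩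
  · simp only [Finset.mem_image, forall_exists_index, and_imp]
    rintro _ k hk rfl
    exact hτ0 k (hJK k hk)
  · obtain ⟨k, hk, hkw⟩ := mem_iUnion₂.1 (hεJ hw)
    exact ⟨τ k, Finset.mem_image_of_mem _ hk,
      (hγJ k hk).trans (le_of_lt (lt_of_lt_of_le hkw (hball _ _)))⟩

theorem exists_forall_le_sum_measureReal_ball (hFeller : M.Feller) {K : Set X}
    (hK : IsCompact K) {z : X}
    (hz : ∀ k ∈ K, ∃ t : ℝ, 0 ≤ t ∧ z ∈ msupport (M.P t k)) {Y : X → ℝ → X} {D : Set X}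
    (hattr : ∀ ε : ℝ, 0 < ε → ∃ T : ℝ, ∀ x ∈ D, ∀ t : ℝ, T ≤ t → Y x t ∈ thickening ε K)
    (hstab : ∀ ε : ℝ, 0 < ε → ∀ t : ℝ, 0 < t → ∃ c : ℝ, 0 < c ∧
      ∀ x ∈ D, ENNReal.ofReal c ≤ M.P t x (ball (Y x t) ε))
    {δ : ℝ} (hδ : 0 < δ) :
    ∃ I : Finset ℝ, (∀ s ∈ I, 0 ≤ s) ∧ ∃ α : ℝ, 0 < α ∧
      ∀ y ∈ D, α ≤ ∑ s ∈ I, (M.P s y).real (ball z δ) := by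
  obtain ⟨I, hI0, γ, hγ, ε, hε, hI⟩ :=
    exists_forall_thickening_le_measureReal_ball hFeller hK hz hδ
  obtain ⟨T₀, hT₀⟩ := hattr (ε / 2) (half_pos hε)
  set T := max T₀ 1
  have hT : 0 < T := lt_max_of_lt_right one_pos
  obtain ⟨c, hc, hcD⟩ := hstab (ε / 2) (half_pos hε) T hT
  have hmeas : ∀ s, Measurable fun w => (M.P s w).real (ball z δ) := fun s =>
    ((Measure.measurable_coe measurableSet_ball).comp (M.measurable_P s)).ennreal_toReal
  have hint : ∀ s y, Integrable (fun w => (M.P s w).real (ball z δ)) (M.P T y) := fun s y =>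
    Integrable.of_bound (hmeas s).aestronglyMeasurable 1 (ae_of_all _ fun w => by
      rw [Real.norm_eq_abs, abs_of_nonneg measureReal_nonneg]
      exact measureReal_le_one)
  refine ⟨I.map (addLeftEmbedding T), ?_, c * γ, by positivity, fun y hy => ?_⟩
  · simp only [Finset.mem_map, forall_exists_index, and_imp, addLeftEmbedding_apply]
    rintro _ s hs rfl
    exact add_nonneg hT.le (hI0 s hs)
  rw [Finset.sum_map]
  simp only [addLeftEmbedding_apply]
  rw [Finset.sum_congr rfl fun s hs => measureReal_add_eq_integral hT.le (hI0 s hs) y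
    measurableSet_ball, ← integral_finsetSum _ fun s _ => hint s y]
  set A := ball (Y y T) (ε / 2)
  have hA : A ⊆ thickening ε K := fun w hw => by
    obtain ⟨k, hk, hkY⟩ := mem_thickening_iff.1 (hT₀ y hy T (le_max_left _ _))
    refine mem_thickening_iff.2 ⟨k, hk, ?_⟩
    have := dist_triangle w (Y y T) k
    have : dist w (Y y T) < ε / 2 := hw
    linarith
  have hcA : c ≤ (M.P T y).real A := by
    rw [measureReal_def, ← ENNReal.ofReal_le_iff_le_toReal (measure_ne_top _ _)]
    exact hcD y hy
  calc c * γ ≤ (M.P T y).real A * γ := by gcongr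
    _ = ∫ w, A.indicator (fun _ => γ) w ∂(M.P T y) := by
        rw [integral_indicator measurableSet_ball]; simp [A]
    _ ≤ _ := by
        refine integral_mono ((integrable_const γ).indicator measurableSet_ball)
          (integrable_finsetSum _ fun s _ => hint s y) fun w => ?_
        by_cases hw : w ∈ A
        · obtain ⟨s, hs, hγs⟩ := hI w (hA hw)
          simp only [indicator_of_mem hw]
          exact hγs.trans (Finset.single_le_sum (f := fun s => (M.P s w).real (ball z δ))
            (fun _ _ => measureReal_nonneg) hs)
        · simp only [indicator_of_notMem hw]
          exact Finset.sum_nonneg fun _ _ => measureReal_nonneg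

end Metric

variable (M) in
/-- The uniform mixture of the transition kernels at the times in `I`. -/
def mixture (I : Finset ℝ) (y : X) : Measure X := (I.card : ENNReal)⁻¹ • ∑ s ∈ I, M.P s y

variable {I : Finset ℝ}

theorem lintegral_mixture (f : X → ENNReal) (y : X) :
    ∫⁻ w, f w ∂(M.mixture I y) = (I.card : ENNReal)⁻¹ * ∑ s ∈ I, ∫⁻ w, f w ∂(M.P s y) := by
  rw [mixture, lintegral_smul_measure, lintegral_finsetSum_measure, smul_eq_mul]

theorem mixture_apply (A : Set X) (y : X) :
    M.mixture I y A = (I.card : ENNReal)⁻¹ * ∑ s ∈ I, M.P s y A := by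
  simp [mixture]

theorem measurable_mixture : Measurable (M.mixture I) := by
  refine Measure.measurable_of_measurable_coe _ fun A hA => ?_
  simp only [mixture_apply]
  exact (Finset.measurable_sum _ fun s _ =>
    (Measure.measurable_coe hA).comp (M.measurable_P s)).const_mul _

theorem isProbabilityMeasure_mixture (hI : I.Nonempty) (y : X) :
    IsProbabilityMeasure (M.mixture I y) := by
  refine ⟨?_⟩
  rw [mixture_apply]
  simp only [measure_univ, Finset.sum_const, nsmul_eq_mul, mul_one]
  exact ENNReal.inv_mul_cancel (by simpa using hI.ne_empty) (ENNReal.natCast_ne_top _)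

theorem measureReal_mixture (A : Set X) (y : X) :
    (M.mixture I y).real A = (I.card : ℝ)⁻¹ * ∑ s ∈ I, (M.P s y).real A := by
  simp only [measureReal_def, mixture_apply, ENNReal.toReal_mul, ENNReal.toReal_inv,
    ENNReal.toReal_natCast]
  rw [ENNReal.toReal_sum fun s _ => measure_ne_top _ _]

theorem integral_mixture {f : X → ℝ} (hf : Measurable f) {C : ℝ} (hC : ∀ x, |f x| ≤ C) (y : X) :
    ∫ w, f w ∂(M.mixture I y) = (I.card : ℝ)⁻¹ * ∑ s ∈ I, M.act s f y := by
  rw [mixture, integral_smul_measure, integral_finsetSum_measure fun s _ =>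
    Integrable.of_bound hf.aestronglyMeasurable C (ae_of_all _ hC)]
  simp [act]

theorem dual_bind_mixture_le (hI : I.Nonempty) (hI0 : ∀ s ∈ I, 0 ≤ s) {ρ : Measure X}
    {A : Set X} (hA : MeasurableSet A) {c : ENNReal} (hρ : ∀ s : ℝ, 0 ≤ s → M.dual s ρ A ≤ c)
    {s : ℝ} (hs : 0 ≤ s) : M.dual s (ρ.bind (M.mixture I)) A ≤ c := by
  have hm : ∀ s, Measurable fun w => M.P s w A := fun s =>
    (Measure.measurable_coe hA).comp (M.measurable_P s)
  have hdual : ∀ s (ν : Measure X), M.dual s ν A = ∫⁻ w, M.P s w A ∂ν := fun s ν =>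
    Measure.bind_apply hA (M.measurable_P s).aemeasurable
  have hsem : ∀ r ∈ I, ∀ y, ∫⁻ w, M.P s w A ∂(M.P r y) = M.P (r + s) y A := fun r hr y => by
    rw [M.semigroup r s (hI0 r hr) hs, Measure.bind_apply hA (M.measurable_P s).aemeasurable]
  rw [hdual, Measure.lintegral_bind measurable_mixture.aemeasurable (hm s).aemeasurable]
  simp only [lintegral_mixture]
  rw [lintegral_const_mul _ (Finset.measurable_sum _ fun r _ => ?_)]
  · rw [lintegral_finsetSum _ fun r _ => ?_]
    · calc (I.card : ENNReal)⁻¹ * ∑ r ∈ I, ∫⁻ y, ∫⁻ w, M.P s w A ∂(M.P r y) ∂ρ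
          ≤ (I.card : ENNReal)⁻¹ * ∑ r ∈ I, c := by
            gcongr with r hr
            simp only [hsem r hr]
            rw [← hdual]
            exact hρ _ (add_nonneg (hI0 r hr) hs)
        _ = c := by
            rw [Finset.sum_const, nsmul_eq_mul, ← mul_assoc,
              ENNReal.inv_mul_cancel (by simpa using hI.ne_empty) (ENNReal.natCast_ne_top _),
              one_mul]
    · exact (Measure.measurable_lintegral (hm s)).comp (M.measurable_P r)
  · exact (Measure.measurable_lintegral (hm s)).comp (M.measurable_P r)

section Averages

variable {ψ : X → ℝ} {C : ℝ}

theorem abs_act_avg_sub_le (hψ : Measurable ψ) (hC : ∀ x, |ψ x| ≤ C) {s S : ℝ} (hs : 0 ≤ s)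
    (hS : 0 < S) (y : X) :
    |M.act s (M.avg ψ S) y - M.avg ψ S y| ≤ 2 * C * s / S := by
  rw [act, M.integral_avg hψ hC hS hs]
  exact abs_timeAvg_shift_sub_le (M.measurable_act_time hψ y) (fun r => M.abs_act_le hC r y) hs hS

theorem abs_integral_mixture_avg_sub_le (hI : I.Nonempty) (hI0 : ∀ s ∈ I, 0 ≤ s)
    (hψ : Measurable ψ) (hC : ∀ x, |ψ x| ≤ C) {S : ℝ} (hS : 0 < S) (y : X) :
    |∫ w, M.avg ψ S w ∂(M.mixture I y) - M.avg ψ S y| ≤ 2 * C * (∑ s ∈ I, s) / S := by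
  have hC0 : 0 ≤ C := (abs_nonneg _).trans (hC y)
  have hN : (1 : ℝ) ≤ I.card := by exact_mod_cast hI.card_pos
  have hN0 : (0 : ℝ) < I.card := by linarith
  rw [integral_mixture (M.measurable_avg hψ hS) (M.abs_avg_le hC hS)]
  have e : (I.card : ℝ)⁻¹ * ∑ s ∈ I, M.act s (M.avg ψ S) y - M.avg ψ S y
      = (I.card : ℝ)⁻¹ * ∑ s ∈ I, (M.act s (M.avg ψ S) y - M.avg ψ S y) := by
    rw [Finset.sum_sub_distrib, Finset.sum_const, nsmul_eq_mul]
    field_simp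
  rw [e, abs_mul, abs_of_pos (inv_pos.2 hN0)]
  calc (I.card : ℝ)⁻¹ * |∑ s ∈ I, (M.act s (M.avg ψ S) y - M.avg ψ S y)|
      ≤ 1 * ∑ s ∈ I, 2 * C * s / S := by
        gcongr
        · exact inv_le_one_of_one_le₀ hN
        · exact (Finset.abs_sum_le_sum_abs _ _).trans
            (Finset.sum_le_sum fun s hs => abs_act_avg_sub_le hψ hC (hI0 s hs) hS y)
    _ = _ := by rw [one_mul, ← Finset.sum_div, ← Finset.mul_sum]

end Averages

section Metric

variable [MetricSpace X] [BorelSpace X]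

/-- Uniformly in `t`, the mean of `avg ψ S` under `P_t(x, ·)` is close to `avg ψ S z`. -/
theorem exists_forall_abs_act_avg_sub_le (hE : M.EProperty) {x z : X}
    (hD : ∀ ε : ℝ, 0 < ε → ∃ D : Set X, MeasurableSet D ∧ D.Nonempty ∧
      (∀ t : ℝ, 0 ≤ t → M.P t x Dᶜ ≤ ENNReal.ofReal ε) ∧
      ∀ δ : ℝ, 0 < δ → ∃ I : Finset ℝ, (∀ s ∈ I, 0 ≤ s) ∧ ∃ α : ℝ, 0 < α ∧
        ∀ y ∈ D, α ≤ ∑ s ∈ I, (M.P s y).real (ball z δ))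
    {ψ : X → ℝ} (hψ : IsBddLipschitz ψ) {η : ℝ} (hη : 0 < η) :
    ∃ S₀ : ℝ, 0 < S₀ ∧ ∀ S : ℝ, S₀ ≤ S → ∀ t : ℝ, 0 ≤ t →
      |M.act t (M.avg ψ S) x - M.avg ψ S z| ≤ η := by
  have hψm : Measurable ψ := hψ.1.choose_spec.continuous.measurable
  obtain ⟨δ, hδ, hδE⟩ := hE ψ hψ z (η / 4) (by positivity)
  obtain ⟨C, hC⟩ := hψ.2
  have hC0 : 0 ≤ C := (abs_nonneg _).trans (hC x)
  obtain ⟨ε, hε, hεC⟩ : ∃ ε : ℝ, 0 < ε ∧ 2 * C * ε ≤ η / 4 := by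
    refine ⟨η / 4 / (2 * C + 1), by positivity, ?_⟩
    rw [mul_div_assoc', div_le_iff₀ (by positivity)]
    nlinarith
  obtain ⟨D, hDm, ⟨y₀, hy₀⟩, hDx, hDI⟩ := hD ε hε
  obtain ⟨I, hI0, α, hα, hIα⟩ := hDI δ hδ
  have hI : I.Nonempty := by
    rw [Finset.nonempty_iff_ne_empty]
    rintro rfl
    have := hIα y₀ hy₀
    simp at this
    linarith
  have hN0 : (0 : ℝ) < I.card := by exact_mod_cast hI.card_pos
  have hUB : ∀ y ∈ D, (I.card : ℝ)⁻¹ * α ≤ (M.mixture I y).real (ball z δ) := fun y hy => by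
    rw [measureReal_mixture]
    gcongr
    exact hIα y hy
  have hα0 : 0 < (I.card : ℝ)⁻¹ * α := by positivity
  have hα1 : (I.card : ℝ)⁻¹ * α ≤ 1 := by
    have := M.isProbabilityMeasure_mixture hI y₀
    exact (hUB y₀ hy₀).trans measureReal_le_one
  set α' := (I.card : ℝ)⁻¹ * α
  obtain ⟨k, hk⟩ : ∃ k : ℕ, 2 * C * (1 - α') ^ k ≤ η / 4 := by
    have h := (tendsto_pow_atTop_nhds_zero_of_lt_one (r := 1 - α') (by linarith)
      (by linarith)).const_mul (2 * C)
    rw [mul_zero] at h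
    exact (h.eventually_le_const (by positivity : 0 < η / 4)).exists
  set σ := ∑ s ∈ I, s
  have hσ : 0 ≤ σ := Finset.sum_nonneg hI0
  refine ⟨k * (2 * C * σ) / (η / 4) + 1, by positivity, fun S hS t ht => ?_⟩
  have hS0 : 0 < S := lt_of_lt_of_le (by positivity) hS
  have hkS : k * (2 * C * σ / S) ≤ η / 4 := by
    rw [mul_div_assoc', div_le_iff₀ hS0, ← div_le_iff₀' (by positivity)]
    linarith
  have havg := M.measurable_avg hψm hS0
  set G : X → ℝ := fun y => |M.avg ψ S y - M.avg ψ S z| with hG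
  have hGm : Measurable G := (havg.sub_const _).abs
  have hGC : ∀ y, G y ≤ 2 * C := fun y => by
    have h1 := M.abs_avg_le hC hS0 y
    have h2 := M.abs_avg_le hC hS0 z
    exact (abs_sub _ _).trans (by linarith)
  have hGB : ∀ y ∈ ball z δ, G y ≤ η / 4 := fun y hy => by
    simp only [hG, avg]
    rw [timeAvg_sub (intervalIntegrable_of_bounded (M.measurable_act_time hψm y)
      (fun r => M.abs_act_le hC r y) _ _) (intervalIntegrable_of_bounded
      (M.measurable_act_time hψm z) (fun r => M.abs_act_le hC r z) _ _)]
    exact abs_timeAvg_le hS0 fun r hr => (hδE y hy r hr).le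
  have hGU : ∀ y, G y ≤ ∫ w, G w ∂(M.mixture I y) + 2 * C * σ / S := fun y => by
    have := M.isProbabilityMeasure_mixture hI y
    have hi : Integrable (M.avg ψ S) (M.mixture I y) :=
      Integrable.of_bound havg.aestronglyMeasurable C (ae_of_all _ (M.abs_avg_le hC hS0))
    have h1 : |∫ w, M.avg ψ S w ∂(M.mixture I y) - M.avg ψ S y| ≤ 2 * C * σ / S :=
      abs_integral_mixture_avg_sub_le hI hI0 hψm hC hS0 y
    have h2 : |∫ w, M.avg ψ S w ∂(M.mixture I y) - M.avg ψ S z| ≤ ∫ w, G w ∂(M.mixture I y) := by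
      have := abs_integral_le_integral_abs (μ := M.mixture I y)
        (f := fun w => M.avg ψ S w - M.avg ψ S z)
      rwa [integral_sub hi (integrable_const _), integral_const, probReal_univ, one_smul] at this
    have h3 : G y ≤ _ :=
      abs_sub_le (M.avg ψ S y) (∫ w, M.avg ψ S w ∂(M.mixture I y)) (M.avg ψ S z)
    rw [abs_sub_comm (M.avg ψ S y)] at h3
    linarith
  have hmain := integral_le_of_hitting (measurable_mixture (M := M) (I := I))
    (M.isProbabilityMeasure_mixture hI) hGm (fun _ => abs_nonneg _) hGC measurableSet_ball hDm
    hα0.le hα1 (by positivity : 0 ≤ 2 * C * σ / S) (by positivity) hε.le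
    (by positivity : 0 ≤ η / 4) hUB hGB hGU
    (Good := fun ρ => ∀ s : ℝ, 0 ≤ s → M.dual s ρ Dᶜ ≤ ENNReal.ofReal ε)
    (fun ρ hρ s hs => dual_bind_mixture_le hI hI0 hDm.compl hρ hs)
    (fun ρ ρ' hle hρ s hs => by
      refine le_trans ?_ (hρ s hs)
      simp only [dual, Measure.bind_apply hDm.compl (M.measurable_P s).aemeasurable]
      exact lintegral_mono' hle le_rfl)
    (fun ρ hρ => by
      have h := hρ 0 le_rfl
      have e : M.P 0 = Measure.dirac := funext M.init
      rwa [dual, e, Measure.bind_dirac] at h)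
    k (M.P t x) (fun s hs => by rw [dual, ← M.semigroup t s ht hs]; exact hDx _ (add_nonneg ht hs))
  rw [probReal_univ, mul_one, mul_one] at hmain
  have hi : Integrable (M.avg ψ S) (M.P t x) :=
    Integrable.of_bound havg.aestronglyMeasurable C (ae_of_all _ (M.abs_avg_le hC hS0))
  have h2 : |M.act t (M.avg ψ S) x - M.avg ψ S z| ≤ ∫ w, G w ∂(M.P t x) := by
    have := abs_integral_le_integral_abs (μ := M.P t x)
      (f := fun w => M.avg ψ S w - M.avg ψ S z)
    rwa [integral_sub hi (integrable_const _), integral_const, probReal_univ, one_smul] at this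
  have h3 : 2 * C * (ε * (1 - (1 - α') ^ k)) ≤ 2 * C * ε := by
    have : 0 ≤ (1 - α') ^ k := pow_nonneg (by linarith) k
    have : 0 ≤ 2 * C * ε * (1 - α') ^ k := by positivity
    linarith
  linarith

end Metric

theorem exists_tendsto_avg_of_forall_abs_act_avg_sub_le {ψ : X → ℝ} (hψ : Measurable ψ) {C : ℝ}
    (hC : ∀ x, |ψ x| ≤ C) {z : X}
    (h : ∀ x : X, ∀ η : ℝ, 0 < η → ∃ S₀ : ℝ, 0 < S₀ ∧ ∀ S : ℝ, S₀ ≤ S → ∀ t : ℝ, 0 ≤ t →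
      |M.act t (M.avg ψ S) x - M.avg ψ S z| ≤ η) :
    ∃ l : ℝ, ∀ x, Tendsto (fun T => M.avg ψ T x) atTop (𝓝 l) := by
  have hC0 : 0 ≤ C := (abs_nonneg _).trans (hC z)
  have key : ∀ x : X, ∀ η : ℝ, 0 < η → ∀ᶠ S in atTop, ∀ᶠ T in atTop,
      |M.avg ψ T x - M.avg ψ S z| ≤ η := by
    intro x η hη
    obtain ⟨S₀, hS₀, hS⟩ := h x (η / 2) (half_pos hη)
    filter_upwards [eventually_ge_atTop S₀] with S hSS
    have hS0 : 0 < S := hS₀.trans_le hSS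
    filter_upwards [eventually_ge_atTop (2 * C * S / (η / 2)), eventually_gt_atTop 0] with T hT hT0
    have hm := M.measurable_act_time hψ x
    have h1 : |timeAvg (fun t => timeAvg (fun r => M.act (t + r) ψ x) S) T - M.avg ψ T x|
        ≤ 2 * C * S / T :=
      abs_timeAvg_timeAvg_sub_le hm (fun r => M.abs_act_le hC r x) hS0 hT0
    have h2 : 2 * C * S / T ≤ η / 2 := by
      rw [div_le_iff₀ hT0, ← div_le_iff₀' (half_pos hη)]
      exact hT
    have h3 : |timeAvg (fun t => timeAvg (fun r => M.act (t + r) ψ x) S) T - M.avg ψ S z|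
        ≤ η / 2 := by
      rw [timeAvg_sub_const hT0 (intervalIntegrable_of_bounded
        (measurable_timeAvg_add hm hS0)
        (fun t => abs_timeAvg_le hS0 fun r _ => M.abs_act_le hC (t + r) x) 0 T)]
      refine abs_timeAvg_le hT0 fun t ht => ?_
      rw [← M.integral_avg hψ hC hS0 ht]
      exact hS S hSS t ht
    rw [abs_le] at h1 h3 ⊢
    constructor <;> linarith [h1.1, h1.2, h3.1, h3.2]
  have hcauchy : CauchySeq fun T => M.avg ψ T z := by
    refine Metric.cauchySeq_iff.2 fun ε hε => ?_
    obtain ⟨S, hS⟩ := (key z (ε / 3) (by positivity)).exists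
    obtain ⟨N, hN⟩ := eventually_atTop.1 hS
    refine ⟨N, fun m hm n hn => ?_⟩
    have h1 := abs_le.1 (hN m hm)
    have h2 := abs_le.1 (hN n hn)
    rw [Real.dist_eq, abs_lt]
    constructor <;> linarith [h1.1, h1.2, h2.1, h2.2]
  obtain ⟨l, hl⟩ := cauchySeq_tendsto_of_complete hcauchy
  refine ⟨l, fun x => Metric.tendsto_nhds.2 fun ε hε => ?_⟩
  obtain ⟨S, hS, hSl⟩ := ((key x (ε / 3) (by positivity)).and
    (Metric.tendsto_nhds.1 hl (ε / 3) (by positivity))).exists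
  filter_upwards [hS] with T hT
  have h1 := abs_le.1 hT
  rw [Real.dist_eq, abs_lt] at hSl ⊢
  constructor <;> linarith [h1.1, h1.2, hSl.1, hSl.2]

theorem tendsto_integral_QM_of_tendsto_avg {ψ : X → ℝ} (hψ : Measurable ψ) {C : ℝ}
    (hC : ∀ x, |ψ x| ≤ C) {l : ℝ} (h : ∀ x, Tendsto (fun T => M.avg ψ T x) atTop (𝓝 l))
    (ν : Measure X) [IsProbabilityMeasure ν] :
    Tendsto (fun T => ∫ x, ψ x ∂(M.QM T ν)) atTop (𝓝 l) := by
  have hlim : Tendsto (fun T => ∫ x, M.avg ψ T x ∂ν) atTop (𝓝 (∫ _, l ∂ν)) := by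
    refine tendsto_integral_filter_of_dominated_convergence (fun _ => C) ?_ ?_
      (integrable_const C) (ae_of_all _ h)
    · filter_upwards [eventually_gt_atTop 0] with T hT
      exact (M.measurable_avg hψ hT).aestronglyMeasurable
    · filter_upwards [eventually_gt_atTop 0] with T hT
      exact ae_of_all _ (M.abs_avg_le hC hT)
  rw [integral_const, probReal_univ, one_smul] at hlim
  refine hlim.congr' ?_
  filter_upwards [eventually_gt_atTop 0] with T hT
  exact (M.integral_QM hT ν hψ hC).symm

theorem Feller.isBddContinuous_act [TopologicalSpace X] (hFeller : M.Feller)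
    {t : ℝ} (ht : 0 ≤ t) {f : X → ℝ} (hf : IsBddContinuous f) : IsBddContinuous (M.act t f) :=
  ⟨hFeller t ht f hf, hf.2.imp fun _ hC => M.abs_act_le hC t⟩

section Metric

variable [MetricSpace X] [BorelSpace X]

theorem qTendsto_of_forall_lipschitz {ν μ : Measure X} [IsProbabilityMeasure ν]
    [IsProbabilityMeasure μ] (h : ∀ ψ : X → ℝ, IsBddLipschitz ψ →
      Tendsto (fun T => ∫ x, ψ x ∂(M.QM T ν)) atTop (𝓝 (∫ x, ψ x ∂μ))) :
    M.QTendsto ν μ := by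
  have hprob : ∀ T, IsProbabilityMeasure (M.QM T ν) := fun T => by
    rcases le_or_gt T 0 with hT | hT
    · rwa [QM, if_pos hT]
    · exact M.isProbabilityMeasure_QM hT ν
  let p : ℝ → ProbabilityMeasure X := fun T => ⟨M.QM T ν, hprob T⟩
  have hp : Tendsto p atTop (𝓝 ⟨μ, inferInstance⟩) := by
    refine tendsto_iff_forall_lipschitz_integral_tendsto.2 fun f hb hf => h f ⟨hf, ?_⟩
    obtain ⟨C, hC⟩ := hb
    obtain ⟨z⟩ := nonempty_of_isProbabilityMeasure μ
    refine ⟨|f z| + C, fun x => ?_⟩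
    have := hC x z
    rw [Real.dist_eq] at this
    linarith [abs_sub_abs_le_abs_sub (f x) (f z)]
  rintro f ⟨hf, C, hC⟩
  exact (ProbabilityMeasure.tendsto_iff_forall_integral_tendsto.1 hp)
    (BoundedContinuousFunction.ofNormedAddCommGroup f hf C hC)

theorem eq_of_forall_isBddContinuous_integral_eq {μ ν : Measure X} [IsFiniteMeasure μ]
    [IsFiniteMeasure ν] (h : ∀ f : X → ℝ, IsBddContinuous f → ∫ x, f x ∂μ = ∫ x, f x ∂ν) :
    μ = ν :=
  ext_of_forall_integral_eq_of_IsFiniteMeasure fun f =>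
    h f ⟨f.continuous, ‖f‖, fun x => f.norm_coe_le_norm x⟩

theorem Feller.invariant_of_qTendsto (hFeller : M.Feller) {z : X} {μ : Measure X}
    [IsProbabilityMeasure μ] (h : M.QTendsto (Measure.dirac z) μ) : M.Invariant μ := by
  intro t ht
  have := M.isProbabilityMeasure_dual t μ
  refine eq_of_forall_isBddContinuous_integral_eq fun f hf => ?_
  obtain ⟨C, hC⟩ := hf.2
  have hfm := hf.1.measurable
  have hact := hFeller.isBddContinuous_act ht hf
  rw [dual, integral_bind_of_bounded (M.measurable_P t) (M.prob t) hfm hC]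
  have h1 := h _ hact
  refine tendsto_nhds_unique h1 ?_
  have h2 : Tendsto (fun T : ℝ => 2 * C * t / T) atTop (𝓝 0) :=
    tendsto_const_nhds.div_atTop tendsto_id
  refine (h f hf).congr_dist (squeeze_zero' (Eventually.of_forall fun _ => dist_nonneg) ?_ h2)
  filter_upwards [eventually_gt_atTop 0] with T hT
  rw [dist_comm, Real.dist_eq, ← M.avg_eq_integral_QM_dirac hT z hfm hC,
    ← M.avg_eq_integral_QM_dirac hT z hact.1.measurable (M.abs_act_le hC t)]
  have e : M.avg (M.act t f) T z = timeAvg (fun r => M.act (t + r) f z) T := by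
    simp only [avg, timeAvg]
    congr 1
    refine intervalIntegral.integral_congr fun r hr => ?_
    rw [uIcc_of_le hT.le] at hr
    rw [add_comm, M.act_add hfm hC hr.1 ht]
    rfl
  rw [e]
  exact abs_timeAvg_shift_sub_le (M.measurable_act_time hfm z) (fun r => M.abs_act_le hC r z) ht hT

theorem Invariant.eq_of_qTendsto {μ ν : Measure X} [IsProbabilityMeasure μ]
    [IsProbabilityMeasure ν] (hμ : M.Invariant μ) (h : M.QTendsto μ ν) : μ = ν := by
  refine eq_of_forall_isBddContinuous_integral_eq fun f hf => ?_
  refine tendsto_nhds_unique ?_ (h f hf)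
  refine tendsto_const_nhds.congr' ?_
  filter_upwards [eventually_gt_atTop 0] with T hT
  rw [hμ.QM_eq hT]

theorem Feller.exists_weakStarMeanErgodic [CompleteSpace X] [SecondCountableTopology X]
    [Nonempty X] (hFeller : M.Feller)
    (h : ∀ ψ : X → ℝ, IsBddLipschitz ψ →
      ∃ l : ℝ, ∀ x, Tendsto (fun T => M.avg ψ T x) atTop (𝓝 l)) :
    ∃ μstar : Measure X, IsProbabilityMeasure μstar ∧ M.Invariant μstar ∧
      (∀ μ : Measure X, IsProbabilityMeasure μ → M.Invariant μ → μ = μstar) ∧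
      M.WeakStarMeanErgodic μstar := by
  obtain ⟨z⟩ := ‹Nonempty X›
  have hQM : ∀ ψ : X → ℝ, IsBddLipschitz ψ → ∃ l : ℝ, ∀ ν : Measure X, IsProbabilityMeasure ν →
      Tendsto (fun T => ∫ x, ψ x ∂(M.QM T ν)) atTop (𝓝 l) := fun ψ hψ => by
    obtain ⟨C, hC⟩ := hψ.2
    obtain ⟨l, hl⟩ := h ψ hψ
    exact ⟨l, fun ν _ => tendsto_integral_QM_of_tendsto_avg
      hψ.1.choose_spec.continuous.measurable hC hl ν⟩
  have hnat : Tendsto (fun n : ℕ => (n : ℝ) + 1) atTop atTop :=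
    tendsto_atTop_add_const_right _ _ tendsto_natCast_atTop_atTop
  obtain ⟨μ, hμ⟩ := exists_probabilityMeasure_of_forall_lipschitz_tendsto
    (μ := fun n : ℕ => M.QM (n + 1) (Measure.dirac z))
    (fun n => M.isProbabilityMeasure_QM (by positivity) _)
    (fun ψ hψ => (hQM ψ hψ).imp fun l hl => (hl _ inferInstance).comp hnat)
  have herg : M.WeakStarMeanErgodic μ := fun ν _ => qTendsto_of_forall_lipschitz fun ψ hψ => by
    obtain ⟨l, hl⟩ := hQM ψ hψ
    rw [tendsto_nhds_unique (hμ ψ hψ) ((hl _ inferInstance).comp hnat)]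
    exact hl ν inferInstance
  exact ⟨μ, inferInstance, hFeller.invariant_of_qTendsto (herg (Measure.dirac z) inferInstance),
    fun ν hν hinv => hinv.eq_of_qTendsto (herg ν hν), herg⟩

end Metric

end Mixing

/-- A uniform bound on the mean of a coercive function confines the mass to a ball. -/
theorem exists_forall_measure_compl_closedBall_le {X : Type*} [NormedAddCommGroup X]
    [MeasurableSpace X] [BorelSpace X] {M : MarkovSemigroup X} {Φ : X → ℝ} (hΦ : Measurable Φ)
    (hΦinfty : ∀ C : ℝ, ∃ R : ℝ, ∀ x : X, R ≤ ‖x‖ → C ≤ Φ x) {x : X} {C : ℝ}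
    (hC : ∀ t : ℝ, 0 ≤ t → ∫⁻ y, ENNReal.ofReal (Φ y) ∂(M.P t x) ≤ ENNReal.ofReal C)
    {ε : ℝ} (hε : 0 < ε) :
    ∃ R : ℝ, 0 < R ∧ ∀ t : ℝ, 0 ≤ t → M.P t x (closedBall 0 R)ᶜ ≤ ENNReal.ofReal ε := by
  set c := (|C| + 1) / ε
  have hc : 0 < c := by positivity
  obtain ⟨R, hR⟩ := hΦinfty c
  refine ⟨max R 1, lt_max_of_lt_right one_pos, fun t ht => ?_⟩
  calc M.P t x (closedBall 0 (max R 1))ᶜ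
      ≤ M.P t x {y | ENNReal.ofReal c ≤ ENNReal.ofReal (Φ y)} := by
        refine measure_mono fun y hy => ENNReal.ofReal_le_ofReal (hR y ?_)
        simp only [mem_compl_iff, mem_closedBall, dist_zero_right, not_le] at hy
        exact (le_max_left _ _).trans hy.le
    _ ≤ (∫⁻ y, ENNReal.ofReal (Φ y) ∂(M.P t x)) / ENNReal.ofReal c :=
        meas_ge_le_lintegral_div hΦ.ennreal_ofReal.aemeasurable (by simpa using hc)
          ENNReal.ofReal_ne_top
    _ ≤ ENNReal.ofReal C / ENNReal.ofReal c := by gcongr; exact hC t ht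
    _ = ENNReal.ofReal (C / c) := (ENNReal.ofReal_div_of_pos hc).symm
    _ ≤ ENNReal.ofReal ε := by
        refine ENNReal.ofReal_le_ofReal ((div_le_iff₀ hc).2 ?_)
        rw [mul_div_cancel₀ _ hε.ne']
        linarith [le_abs_self C]

end MarkovSemigroup

/-- Theorem 3 of the paper. Let `X` be a separable real Hilbert space
and `(P_t)` a Feller, stochastically continuous Markov semigroup on `X` with the
e-property. If the deterministic semi-dynamical system `Y` has a compact global
attractor `K`, there is a Lyapunov function `Φ` whose expectations stay bounded along
the process, the family is stochastically stable, and
`⋂_{x∈K} ⋃_{t≥0} supp(P_t^* δ_x) ≠ ∅`, then the semigroup admits a unique invariant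
probability measure and is weak-* mean ergodic. -/
theorem unique_invariant_and_ergodic_of_attractor
    {X : Type*} [NormedAddCommGroup X] [InnerProductSpace ℝ X] [CompleteSpace X]
    [SecondCountableTopology X] [MeasurableSpace X] [BorelSpace X]
    (M : MarkovSemigroup X)
    (hFeller : M.Feller) (hSC : M.StochasticallyContinuous) (hE : M.EProperty)
    -- the semi-dynamical system
    (Y : X → ℝ → X)
    (hY0 : ∀ x, Y x 0 = x)
    (hYcont : ∀ x, ContinuousOn (Y x) (Set.Ici (0 : ℝ)))
    (hYmeas : ∀ t : ℝ, 0 ≤ t → Measurable fun x => Y x t)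
    (hYsemi : ∀ x : X, ∀ t : ℝ, 0 ≤ t → ∀ s : ℝ, 0 ≤ s → Y (Y x t) s = Y x (t + s))
    -- (i) compact global attractor
    (K : Set X) (hKcpt : IsCompact K)
    (hKinv : ∀ x ∈ K, ∀ t : ℝ, 0 ≤ t → Y x t ∈ K)
    (hKattr : ∀ ε : ℝ, 0 < ε → ∀ R : ℝ, 0 < R → ∃ T : ℝ,
      ∀ x : X, ‖x‖ ≤ R → ∀ t : ℝ, T ≤ t → Y x t ∈ Metric.thickening ε K)
    -- (ii) Lyapunov function
    (Φ : X → ℝ) (hΦmeas : Measurable Φ) (hΦnn : ∀ x, 0 ≤ Φ x)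
    (hΦbdd : ∀ R : ℝ, 0 < R → ∃ C : ℝ, ∀ x : X, ‖x‖ ≤ R → Φ x ≤ C)
    (hΦinfty : ∀ C : ℝ, ∃ R : ℝ, ∀ x : X, R ≤ ‖x‖ → C ≤ Φ x)
    (hLyap : ∀ x : X, ∃ C : ℝ, ∀ t : ℝ, 0 ≤ t →
      ∫⁻ y, ENNReal.ofReal (Φ y) ∂(M.P t x) ≤ ENNReal.ofReal C)
    -- (iii) stochastic stability and the support condition
    (hSS : ∀ ε : ℝ, 0 < ε → ∀ R : ℝ, 0 < R → ∀ t : ℝ, 0 < t →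
      ∃ c : ℝ, 0 < c ∧ ∀ x : X, ‖x‖ ≤ R →
        ENNReal.ofReal c ≤ (M.P t x) (Metric.ball (Y x t) ε))
    (hsupp : (⋂ x ∈ K, ⋃ t ∈ Set.Ici (0 : ℝ), msupport (M.P t x)).Nonempty) :
    ∃ μstar : MeasureTheory.Measure X,
      MeasureTheory.IsProbabilityMeasure μstar ∧ M.Invariant μstar ∧
      (∀ μ : MeasureTheory.Measure X, MeasureTheory.IsProbabilityMeasure μ →
        M.Invariant μ → μ = μstar) ∧
      M.WeakStarMeanErgodic μstar := by
  obtain ⟨z, hz⟩ := hsupp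
  have hz' : ∀ k ∈ K, ∃ t : ℝ, 0 ≤ t ∧ z ∈ msupport (M.P t k) := fun k hk => by
    simpa using mem_iUnion₂.1 (mem_iInter₂.1 hz k hk)
  refine hFeller.exists_weakStarMeanErgodic fun ψ hψ => ?_
  obtain ⟨C, hC⟩ := hψ.2
  refine MarkovSemigroup.exists_tendsto_avg_of_forall_abs_act_avg_sub_le (z := z)
    hψ.1.choose_spec.continuous.measurable hC fun x η hη =>
      MarkovSemigroup.exists_forall_abs_act_avg_sub_le hE (fun ε hε => ?_) hψ hη
  obtain ⟨B, hB⟩ := hLyap x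
  obtain ⟨R, hR, hRx⟩ :=
    MarkovSemigroup.exists_forall_measure_compl_closedBall_le hΦmeas hΦinfty hB hε
  refine ⟨closedBall 0 R, measurableSet_closedBall, ⟨0, mem_closedBall_self hR.le⟩, hRx,
    fun δ hδ => ?_⟩
  refine MarkovSemigroup.exists_forall_le_sum_measureReal_ball hFeller hKcpt hz' (Y := Y)
    (fun r hr => ?_) (fun r hr t ht => ?_) hδ
  · simpa only [mem_closedBall, dist_zero_right] using hKattr r hr R hR
  · simpa only [mem_closedBall, dist_zero_right] using hSS r hr R hR t ht
end
end

section
/- Suppose a Feller, stochastically continuous Markov transition semigroup (P_t)_{t≥0} on a Polish metric space 𝒳 has the e-property and admits an invariant probability measure μ*. Then supp μ* ⊆ 𝒯, i.e. for every x in the support of μ* the family of measures (Q^T(x,·))_{T>0} is tight. -/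
open MeasureTheory Filter Topology Metric Set

noncomputable section

/-- The distance to a finite set of points, scaled by `K` and capped at `1`. -/
def cappedDist {X : Type*} [PseudoMetricSpace X] (K : NNReal) (G : Finset X) (y : X) : ℝ :=
  min (K * infDist y (G : Set X)) 1

/-- The `K`-Lipschitz functions with values in `[0, 1]`. -/
def unitLipschitz (X : Type*) [PseudoMetricSpace X] (K : NNReal) : Set (X → ℝ) :=
  {ψ | LipschitzWith K ψ} ∩ Set.pi univ fun _ => Icc 0 1

section UnitLipschitz

variable {X : Type*} [PseudoMetricSpace X] {K : NNReal}

theorem mem_unitLipschitz {ψ : X → ℝ} :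
    ψ ∈ unitLipschitz X K ↔ LipschitzWith K ψ ∧ ∀ y, ψ y ∈ Icc (0 : ℝ) 1 := by
  exact and_congr_right fun _ => ⟨fun h y => h y trivial, fun h y _ => h y⟩

theorem isBddLipschitz_of_mem_unitLipschitz [MeasurableSpace X] {ψ : X → ℝ}
    (hψ : ψ ∈ unitLipschitz X K) : IsBddLipschitz ψ := by
  rw [mem_unitLipschitz] at hψ
  exact ⟨⟨K, hψ.1⟩, 1, fun y => abs_le.2 ⟨by linarith [(hψ.2 y).1], (hψ.2 y).2⟩⟩

theorem isCompact_unitLipschitz : IsCompact (unitLipschitz X K) :=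
  (isCompact_univ_pi fun _ => isCompact_Icc).inter_left (isClosed_setOfPred_lipschitzWith K)

theorem lipschitzWith_cappedDist (G : Finset X) : LipschitzWith K (cappedDist K G) := by
  refine LipschitzWith.min_const (LipschitzWith.of_le_add_mul K fun y z => ?_) 1
  rw [← mul_add]
  exact mul_le_mul_of_nonneg_left infDist_le_infDist_add_dist K.coe_nonneg

theorem cappedDist_mem_Icc (G : Finset X) (y : X) : cappedDist K G y ∈ Icc (0 : ℝ) 1 :=
  ⟨le_min (mul_nonneg K.coe_nonneg infDist_nonneg) zero_le_one, min_le_right _ _⟩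

theorem cappedDist_mem_unitLipschitz (G : Finset X) : cappedDist K G ∈ unitLipschitz X K :=
  mem_unitLipschitz.2 ⟨lipschitzWith_cappedDist G, cappedDist_mem_Icc G⟩

theorem cappedDist_of_mem {G : Finset X} {y : X} (hy : y ∈ G) : cappedDist K G y = 0 := by
  simp [cappedDist, infDist_zero_of_mem (Finset.mem_coe.2 hy)]

theorem max_cappedDist_mem_unitLipschitz {ψ : X → ℝ} (hψ : ψ ∈ unitLipschitz X K)
    (G : Finset X) : (fun y => max (ψ y) (cappedDist K G y)) ∈ unitLipschitz X K := by
  rw [mem_unitLipschitz] at hψ ⊢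
  refine ⟨by simpa using hψ.1.max (lipschitzWith_cappedDist (K := K) G), fun y => ?_⟩
  exact ⟨le_max_of_le_left (hψ.2 y).1, max_le (hψ.2 y).2 (cappedDist_mem_Icc G y).2⟩

theorem min_one_sub_cappedDist_mem_unitLipschitz {ψ : X → ℝ} (hψ : ψ ∈ unitLipschitz X K)
    (G : Finset X) : (fun y => min (ψ y) (1 - cappedDist K G y)) ∈ unitLipschitz X K := by
  rw [mem_unitLipschitz] at hψ ⊢
  have h : LipschitzWith K fun y => 1 - cappedDist K G y := by
    refine LipschitzWith.of_dist_le_mul fun y z => ?_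
    simpa only [dist_sub_left] using (lipschitzWith_cappedDist G).dist_le_mul y z
  refine ⟨by simpa using hψ.1.min h, fun y => ?_⟩
  have h01 := cappedDist_mem_Icc (K := K) G y
  exact ⟨le_min (hψ.2 y).1 (by linarith [h01.2]), min_le_of_left_le (hψ.2 y).2⟩

theorem abs_sub_le_of_abs_sub_le_on_finset {ψ φ : X → ℝ} (hψ : ψ ∈ unitLipschitz X K)
    (hφ : φ ∈ unitLipschitz X K) {G : Finset X} (hG : G.Nonempty) {η : ℝ}
    (h : ∀ i ∈ G, |ψ i - φ i| ≤ η) (y : X) :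
    |ψ y - φ y| ≤ η + 2 * cappedDist K G y := by
  rw [mem_unitLipschitz] at hψ hφ
  obtain ⟨i, hi, hd⟩ := G.finite_toSet.isCompact.exists_infDist_eq_dist hG y
  have h0 := h i hi
  rw [cappedDist, hd]
  have h1 := hψ.1.dist_le_mul y i
  have h2 := hφ.1.dist_le_mul y i
  rw [Real.dist_eq] at h1 h2
  obtain ⟨a1, a2⟩ := hψ.2 y
  obtain ⟨b1, b2⟩ := hφ.2 y
  have hη : 0 ≤ η := (abs_nonneg _).trans h0
  rw [abs_le] at *
  rcases min_cases ((K : ℝ) * dist y i) 1 with ⟨e, -⟩ | ⟨e, -⟩ <;> rw [e] <;>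
    constructor <;> linarith [h0.1, h0.2, h1.1, h1.2, h2.1, h2.2]

variable [MeasurableSpace X] [OpensMeasurableSpace X]

theorem integrable_of_mem_unitLipschitz [SecondCountableTopology X] {ψ : X → ℝ}
    (hψ : ψ ∈ unitLipschitz X K) (μ : Measure X) [IsFiniteMeasure μ] : Integrable ψ μ := by
  rw [mem_unitLipschitz] at hψ
  exact Integrable.of_mem_Icc 0 1 hψ.1.continuous.measurable.aemeasurable
    (Eventually.of_forall hψ.2)

/-- A finite set of points can be enlarged so that the mean capped distance to it is small. -/
theorem exists_integral_cappedDist_lt [SecondCountableTopology X] [Nonempty X] (K : NNReal)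
    (μ : Measure X) [IsFiniteMeasure μ] (F : Finset X) {ε : ℝ} (hε : 0 < ε) :
    ∃ G : Finset X, F ⊆ G ∧ G.Nonempty ∧ ∫ y, cappedDist K G y ∂μ < ε := by
  classical
  let u : ℕ → X := TopologicalSpace.denseSeq X
  let G : ℕ → Finset X := fun n => F ∪ (Finset.range (n + 1)).image u
  have hlim : ∀ y, Tendsto (fun n => cappedDist K (G n) y) atTop (𝓝 0) := by
    intro y
    rw [Metric.tendsto_atTop]
    intro η hη
    have hK : (0 : ℝ) < K + 1 := by positivity
    obtain ⟨m, hm⟩ := (TopologicalSpace.denseRange_denseSeq X).exists_dist_lt y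
      (div_pos hη hK)
    refine ⟨m, fun n hn => ?_⟩
    have hmem : u m ∈ (G n : Set X) := by
      simp only [G, Finset.coe_union, Finset.coe_image, Finset.coe_range]
      exact Or.inr ⟨m, by simpa using Nat.lt_succ_of_le hn, rfl⟩
    have h1 := infDist_le_dist_of_mem (x := y) hmem
    have h2 : dist y (u m) * (K + 1) < η := (lt_div_iff₀ hK).1 hm
    have h3 : cappedDist K (G n) y ≤ K * infDist y (G n : Set X) := min_le_left _ _
    have h4 := mul_le_mul_of_nonneg_left h1 K.coe_nonneg
    rw [Real.dist_eq, sub_zero, abs_of_nonneg (cappedDist_mem_Icc _ _).1]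
    nlinarith [dist_nonneg (x := y) (y := u m)]
  have h := tendsto_integral_of_dominated_convergence (μ := μ) (fun _ => (1 : ℝ))
    (fun n => (integrable_of_mem_unitLipschitz
      (cappedDist_mem_unitLipschitz (K := K) (G n)) μ).aestronglyMeasurable)
    (integrable_const 1)
    (fun n => Eventually.of_forall fun y => by
      rw [Real.norm_eq_abs, abs_of_nonneg (cappedDist_mem_Icc _ _).1]
      exact (cappedDist_mem_Icc _ _).2)
    (Eventually.of_forall hlim)
  rw [integral_zero] at h
  obtain ⟨n, hn⟩ := (h.eventually (gt_mem_nhds hε)).exists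
  refine ⟨G n, Finset.subset_union_left, ⟨u 0, ?_⟩, hn⟩
  exact Finset.mem_union_right _ (Finset.mem_image_of_mem _ (by simp))

/-- On uniformly Lipschitz functions with values in `[0, 1]`, integration is continuous for
pointwise convergence. -/
theorem continuousOn_integral_unitLipschitz [SecondCountableTopology X] (K : NNReal)
    (μ : Measure X) [IsProbabilityMeasure μ] :
    ContinuousOn (fun ψ : X → ℝ => ∫ y, ψ y ∂μ) (unitLipschitz X K) := by
  have : Nonempty X := nonempty_of_isProbabilityMeasure μ
  intro φ hφ
  rw [ContinuousWithinAt, Metric.tendsto_nhds]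
  intro ε hε
  obtain ⟨G, -, hGne, hG⟩ := exists_integral_cappedDist_lt K μ ∅ (show 0 < ε / 4 by linarith)
  have hev : ∀ᶠ ψ in 𝓝 φ, ∀ i ∈ G, |ψ i - φ i| < ε / 4 := by
    rw [Filter.eventually_all_finset]
    intro i _
    have := (continuous_apply (A := fun _ : X => ℝ) i).continuousAt (x := φ)
    exact (Metric.tendsto_nhds.1 this) (ε / 4) (by linarith)
  filter_upwards [nhdsWithin_le_nhds hev, self_mem_nhdsWithin] with ψ hψG hψ
  have iψ := integrable_of_mem_unitLipschitz hψ μ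
  have iφ := integrable_of_mem_unitLipschitz hφ μ
  have ih := integrable_of_mem_unitLipschitz (cappedDist_mem_unitLipschitz (K := K) G) μ
  rw [Real.dist_eq, ← integral_sub iψ iφ]
  calc |∫ y, ψ y - φ y ∂μ| ≤ ∫ y, |ψ y - φ y| ∂μ := abs_integral_le_integral_abs
    _ ≤ ∫ y, ε / 4 + 2 * cappedDist K G y ∂μ :=
      integral_mono (iψ.sub iφ).abs ((integrable_const _).add (ih.const_mul 2))
        (abs_sub_le_of_abs_sub_le_on_finset hψ hφ hGne fun i hi => (hψG i hi).le)
    _ = ε / 4 + 2 * ∫ y, cappedDist K G y ∂μ := by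
      rw [integral_add (integrable_const _) (ih.const_mul 2), integral_const_mul]
      simp
    _ < ε := by linarith

end UnitLipschitz

namespace MarkovSemigroup

section Measurability

variable {X : Type*} [MeasurableSpace X] (M : MarkovSemigroup X)

theorem integral_dual (t : ℝ) (μ : Measure X) {f : X → ℝ} (hf : Integrable f (M.dual t μ)) :
    ∫ y, f y ∂(M.dual t μ) = ∫ y, M.act t f y ∂μ := by
  let η : ProbabilityTheory.Kernel X X := ⟨M.P t, M.measurable_P t⟩
  have h := ProbabilityTheory.Kernel.integral_comp (κ := ProbabilityTheory.Kernel.const Unit μ)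
    (η := η) (a := ()) (f := f)
  rw [ProbabilityTheory.Kernel.comp_apply, ProbabilityTheory.Kernel.const_apply] at h
  exact h hf

theorem Q_apply {T : ℝ} (hT : 0 < T) (x : X) {B : Set X} (hB : MeasurableSet B) :
    M.Q T x B = ENNReal.ofReal (1 / T) * ∫⁻ s in Ioc 0 T, M.P s x B := by
  have hd : (fun s => M.dual s (Measure.dirac x)) = fun s => M.P s x :=
    funext fun s => Measure.dirac_bind (M.measurable_P s) x
  have hm : Measurable fun s => M.P s x := M.meas.comp measurable_prodMk_right
  rw [Q, QM, if_neg hT.not_ge, hd, Measure.bind_apply hB hm.aemeasurable, lintegral_smul_measure, smul_eq_mul]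

end Measurability

variable {X : Type*} [MetricSpace X] [SecondCountableTopology X] [MeasurableSpace X]
  [BorelSpace X] (M : MarkovSemigroup X)

/-- By Baire category, the e-property at `x` is uniform over all functions of `unitLipschitz X K`
that agree with a fixed one on a fixed finite set. -/
theorem EProperty.exists_uniform (hE : M.EProperty) (x : X) (K : NNReal) {ε : ℝ} (hε : 0 < ε) :
    ∃ δ : ℝ, 0 < δ ∧ ∃ ψ ∈ unitLipschitz X K, ∃ F : Finset X,
      ∀ φ ∈ unitLipschitz X K, (∀ i ∈ F, φ i = ψ i) →
        ∀ z, dist z x < δ → ∀ t, 0 ≤ t → |M.act t φ z - M.act t φ x| ≤ ε := by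
  have : CompactSpace (unitLipschitz X K) := isCompact_iff_compactSpace.1 isCompact_unitLipschitz
  have : Nonempty (unitLipschitz X K) := ⟨⟨_, cappedDist_mem_unitLipschitz ∅⟩⟩
  let A : ℕ → Set (unitLipschitz X K) := fun n =>
    {φ | ∀ z, dist z x < 1 / ((n : ℝ) + 1) → ∀ t, 0 ≤ t →
      |M.act t φ.1 z - M.act t φ.1 x| ≤ ε}
  have hcont : ∀ t z, Continuous fun φ : unitLipschitz X K => M.act t φ.1 z := fun t z => by
    have := M.prob t z
    exact continuousOn_iff_continuous_domRestrict.1 (continuousOn_integral_unitLipschitz K (M.P t z))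
  have hclosed : ∀ n, IsClosed (A n) := by
    intro n
    have hA : A n = ⋂ (z) (_ : dist z x < 1 / ((n : ℝ) + 1)) (t : ℝ) (_ : 0 ≤ t),
        {φ : unitLipschitz X K | |M.act t φ.1 z - M.act t φ.1 x| ≤ ε} := by
      ext φ
      simp [A]
    rw [hA]
    exact isClosed_iInter fun z => isClosed_iInter fun _ => isClosed_iInter fun t =>
      isClosed_iInter fun _ => isClosed_le ((hcont t z).sub (hcont t x)).abs continuous_const
  have hU : ⋃ n, A n = univ := by
    refine eq_univ_of_forall fun φ => ?_
    obtain ⟨δ, hδ, h⟩ := hE φ.1 (isBddLipschitz_of_mem_unitLipschitz φ.2) x ε hε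
    obtain ⟨n, hn⟩ := exists_nat_one_div_lt hδ
    exact mem_iUnion.2 ⟨n, fun z hz t ht => (h z (hz.trans hn) t ht).le⟩
  obtain ⟨n, ψ, hψ⟩ := nonempty_interior_of_iUnion_of_closed hclosed hU
  obtain ⟨V, hV, hVA⟩ := isOpen_induced_iff.1 (isOpen_interior (s := A n))
  have hψV : ψ.1 ∈ V := by
    rw [← hVA] at hψ
    exact hψ
  obtain ⟨F, u, hu, hFV⟩ := isOpen_pi_iff.1 hV ψ.1 hψV
  refine ⟨1 / ((n : ℝ) + 1), by positivity, ψ.1, ψ.2, F, fun φ hφ hF => ?_⟩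
  have hφV : φ ∈ V := hFV fun i hi => by
    rw [hF i hi]
    exact (hu i hi).2
  have hφA : (⟨φ, hφ⟩ : unitLipschitz X K) ∈ interior (A n) := by
    rw [← hVA]
    exact hφV
  exact interior_subset hφA

/-- At a point of the support of an invariant probability measure, the e-property bounds,
uniformly in time, the mass of the transition probabilities far from a finite set. -/
theorem EProperty.exists_finset_measure_le (hFeller : M.Feller) (hE : M.EProperty)
    {μ : Measure X} [IsProbabilityMeasure μ] (hinv : M.Invariant μ) {x : X}
    (hx : x ∈ msupport μ) (K : NNReal) {ε : ℝ} (hε : 0 < ε) :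
    ∃ G : Finset X, G.Nonempty ∧ ∀ t, 0 ≤ t →
      (M.P t x).real {y | 1 ≤ K * infDist y (G : Set X)} ≤ ε := by
  have : Nonempty X := ⟨x⟩
  obtain ⟨δ, hδ, ψ, hψ, F, hF⟩ := hE.exists_uniform M x K (show 0 < ε / 3 by linarith)
  have hB : 0 < μ.real (ball x δ) :=
    ENNReal.toReal_pos (hx _ isOpen_ball (mem_ball_self hδ)).ne' (measure_ne_top _ _)
  obtain ⟨G, hFG, hGne, hG⟩ := exists_integral_cappedDist_lt K μ F
    (show 0 < ε / 3 * μ.real (ball x δ) by positivity)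
  refine ⟨G, hGne, fun t ht => ?_⟩
  have hprob := M.prob t
  set h : X → ℝ := cappedDist K G
  have h01 : ∀ y, h y ∈ Icc (0 : ℝ) 1 := cappedDist_mem_Icc G
  set φ₁ : X → ℝ := fun y => max (ψ y) (h y)
  set φ₂ : X → ℝ := fun y => min (ψ y) (1 - h y)
  have hφ₁ : φ₁ ∈ unitLipschitz X K := max_cappedDist_mem_unitLipschitz hψ G
  have hφ₂ : φ₂ ∈ unitLipschitz X K := min_one_sub_cappedDist_mem_unitLipschitz hψ G
  have hψ01 := (mem_unitLipschitz.1 hψ).2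
  set g : X → ℝ := fun y => φ₁ y - φ₂ y with hg
  have hg_nonneg : ∀ y, 0 ≤ g y := fun y =>
    sub_nonneg.2 ((min_le_left _ _).trans (le_max_left _ _))
  have hg_le : ∀ y, g y ≤ h y := fun y => by
    have := h01 y
    have := hψ01 y
    simp only [mem_Icc] at *
    rcases max_cases (ψ y) (h y) with ⟨e, _⟩ | ⟨e, _⟩ <;>
      rcases min_cases (ψ y) (1 - h y) with ⟨e', _⟩ | ⟨e', _⟩ <;>
        simp only [hg, φ₁, φ₂, e, e'] <;> linarith
  have hg_one : ∀ y, h y = 1 → 1 ≤ g y := fun y hy => by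
    have h1 : 1 ≤ φ₁ y := hy ▸ le_max_right (ψ y) (h y)
    have h2 : φ₂ y ≤ 0 := (min_le_right _ _).trans (by linarith)
    simp only [hg]
    linarith
  have hg_int : ∀ (ν : Measure X) [IsFiniteMeasure ν], Integrable g ν := fun ν _ =>
    (integrable_of_mem_unitLipschitz hφ₁ ν).sub (integrable_of_mem_unitLipschitz hφ₂ ν)
  have hact : ∀ y, M.act t g y = M.act t φ₁ y - M.act t φ₂ y := fun y =>
    integral_sub (integrable_of_mem_unitLipschitz hφ₁ _) (integrable_of_mem_unitLipschitz hφ₂ _)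
  have hclose : ∀ z ∈ ball x δ, M.act t g x - 2 * (ε / 3) ≤ M.act t g z := fun z hz => by
    have h1 := abs_le.1 (hF φ₁ hφ₁ (fun i hi => by
      simp [φ₁, h, cappedDist_of_mem (hFG hi), (hψ01 i).1]) z hz t ht)
    have h2 := abs_le.1 (hF φ₂ hφ₂ (fun i hi => by
      simp [φ₂, h, cappedDist_of_mem (hFG hi), (hψ01 i).2]) z hz t ht)
    rw [hact, hact]
    linarith [h1.1, h2.2]
  have hact_nonneg : ∀ y, 0 ≤ M.act t g y := fun y => integral_nonneg hg_nonneg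
  have hact_int : Integrable (M.act t g) μ := by
    have hgc : IsBddContinuous g := ⟨(mem_unitLipschitz.1 hφ₁).1.continuous.sub
      (mem_unitLipschitz.1 hφ₂).1.continuous, 1, fun y =>
        abs_le.2 ⟨by linarith [hg_nonneg y], (hg_le y).trans (h01 y).2⟩⟩
    refine Integrable.of_mem_Icc 0 1 (hFeller t ht g hgc).measurable.aemeasurable
      (Eventually.of_forall fun y => ⟨hact_nonneg y, ?_⟩)
    have := integral_mono (hg_int (M.P t y)) (integrable_const 1)
      fun z => (hg_le z).trans (h01 z).2
    simpa [act] using this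
  have hx_le : M.act t g x ≤ ε := by
    have hdual : ∫ y, M.act t g y ∂μ = ∫ y, g y ∂μ := by
      have := M.integral_dual t μ (f := g) (by rw [hinv t ht]; exact hg_int μ)
      rw [← this, hinv t ht]
    have h1 : (M.act t g x - 2 * (ε / 3)) * μ.real (ball x δ) ≤
        ∫ y in ball x δ, M.act t g y ∂μ := by
      have := setIntegral_mono_on (μ := μ) (s := ball x δ)
        (integrable_const (M.act t g x - 2 * (ε / 3))).integrableOn hact_int.integrableOn
        measurableSet_ball hclose
      rw [setIntegral_const, smul_eq_mul] at this
      linarith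
    have h2 : ∫ y in ball x δ, M.act t g y ∂μ ≤ ∫ y, M.act t g y ∂μ :=
      setIntegral_le_integral hact_int (Eventually.of_forall hact_nonneg)
    have h3 : ∫ y, g y ∂μ ≤ ∫ y, h y ∂μ :=
      integral_mono (hg_int μ)
        (integrable_of_mem_unitLipschitz (cappedDist_mem_unitLipschitz G) μ) hg_le
    have h4 : M.act t g x - 2 * (ε / 3) < ε / 3 :=
      lt_of_mul_lt_mul_right (by linarith) hB.le
    linarith
  have hsub : {y | 1 ≤ K * infDist y (G : Set X)} ⊆ {y | 1 ≤ g y} := fun y hy =>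
    hg_one y (min_eq_right hy)
  have hmarkov := mul_meas_ge_le_integral_of_nonneg (μ := M.P t x)
    (Eventually.of_forall hg_nonneg) (hg_int _) 1
  rw [one_mul] at hmarkov
  exact (measureReal_mono hsub).trans (hmarkov.trans hx_le)

/-- At a point of the support of an invariant probability measure, the e-property makes the
transition probabilities uniformly tight. -/
theorem EProperty.exists_isCompact [CompleteSpace X] (hFeller : M.Feller) (hE : M.EProperty)
    {μ : Measure X} [IsProbabilityMeasure μ] (hinv : M.Invariant μ) {x : X}
    (hx : x ∈ msupport μ) {ε : ℝ} (hε : 0 < ε) :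
    ∃ C : Set X, IsCompact C ∧ ∀ t, 0 ≤ t → M.P t x Cᶜ ≤ ENNReal.ofReal ε := by
  obtain ⟨η, hη, hsum⟩ := NNReal.exists_pos_sum_of_countable (ε := ⟨ε, hε.le⟩)
    (fun h => hε.ne' (congrArg NNReal.toReal h)) ℕ
  choose G hGne hG using fun n : ℕ =>
    hE.exists_finset_measure_le M hFeller hinv hx ((n : NNReal) + 1) (NNReal.coe_pos.2 (hη n))
  let C : ℕ → Set X := fun n => {y | ((n : ℝ) + 1) * infDist y (G n : Set X) ≤ 1}
  have hC : ∀ n, IsClosed (C n) := fun n =>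
    isClosed_le (continuous_const.mul (continuous_infDist_pt _)) continuous_const
  refine ⟨⋂ n, C n, ?_, fun t ht => ?_⟩
  · refine isCompact_iff_totallyBounded_isComplete.2
      ⟨Metric.totallyBounded_iff.2 fun r hr => ?_, (isClosed_iInter hC).isComplete⟩
    obtain ⟨n, hn⟩ := exists_nat_one_div_lt hr
    refine ⟨G n, (G n).finite_toSet, fun y hy => ?_⟩
    have hyn : ((n : ℝ) + 1) * infDist y (G n : Set X) ≤ 1 := mem_iInter.1 hy n
    obtain ⟨i, hi, hd⟩ := (G n).finite_toSet.isCompact.exists_infDist_eq_dist (hGne n) y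
    rw [hd, ← le_div_iff₀' (by positivity)] at hyn
    exact mem_iUnion₂.2 ⟨i, hi, hyn.trans_lt hn⟩
  · have hprob := M.prob t x
    rw [compl_iInter]
    refine (measure_iUnion_le _).trans ?_
    have hle : ∀ n, M.P t x (C n)ᶜ ≤ (η n : ENNReal) := fun n => by
      have hsub : (C n)ᶜ ⊆ {y | 1 ≤ (((n : NNReal) + 1 : NNReal) : ℝ) *
          infDist y (G n : Set X)} := fun y hy => by
        have h1 : ¬((n : ℝ) + 1) * infDist y (G n : Set X) ≤ 1 := hy
        simpa using (not_le.1 h1).le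
      rw [← ENNReal.ofReal_coe_nnreal, ENNReal.le_ofReal_iff_toReal_le (measure_ne_top _ _)
        (η n).coe_nonneg]
      exact (measureReal_mono hsub).trans (hG n t ht)
    obtain ⟨c, hc, hcε⟩ := hsum
    calc ∑' n, M.P t x (C n)ᶜ ≤ ∑' n, (η n : ENNReal) := ENNReal.tsum_le_tsum hle
      _ = c := ENNReal.tsum_coe_eq hc
      _ ≤ ENNReal.ofReal ε := by
        rw [← ENNReal.ofReal_coe_nnreal]
        exact ENNReal.ofReal_le_ofReal hcε.le

end MarkovSemigroup

/-- Proposition 1 of the paper. If a Feller, stochastically continuous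
Markov semigroup has the e-property and admits an invariant probability measure `μ*`,
then every point of the support of `μ*` has tight ergodic averages, i.e.
`supp μ* ⊆ 𝒯`. -/
theorem support_subset_tight_of_invariant
    {X : Type*} [MetricSpace X] [CompleteSpace X] [SecondCountableTopology X]
    [MeasurableSpace X] [BorelSpace X]
    (M : MarkovSemigroup X)
    (hFeller : M.Feller) (hSC : M.StochasticallyContinuous) (hE : M.EProperty)
    (μstar : MeasureTheory.Measure X)
    (hprob : MeasureTheory.IsProbabilityMeasure μstar)
    (hinv : M.Invariant μstar) :
    ∀ x ∈ msupport μstar, M.TightAt x := by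
  intro x hx ε hε
  obtain ⟨C, hC, hle⟩ := hE.exists_isCompact M hFeller hinv hx hε
  have hCm : MeasurableSet C := hC.isClosed.measurableSet
  have hT_inv : ∀ T : ℝ, 0 < T → ENNReal.ofReal (1 / T) * ENNReal.ofReal T = 1 := fun T hT => by
    rw [← ENNReal.ofReal_mul (by positivity), one_div_mul_cancel hT.ne', ENNReal.ofReal_one]
  refine ⟨C, hC, fun T hT => ?_⟩
  have hupper : M.Q T x C ≤ 1 := by
    rw [M.Q_apply hT x hCm, ← hT_inv T hT]
    gcongr
    calc ∫⁻ s in Ioc 0 T, M.P s x C ≤ ∫⁻ _ in Ioc 0 T, 1 :=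
          lintegral_mono fun s => by
            have := M.prob s x
            exact prob_le_one
      _ = ENNReal.ofReal T := by simp
  have hlower : ENNReal.ofReal (1 - ε) ≤ M.Q T x C := by
    rw [M.Q_apply hT x hCm]
    calc ENNReal.ofReal (1 - ε)
        = ENNReal.ofReal (1 / T) * ∫⁻ _ in Ioc 0 T, ENNReal.ofReal (1 - ε) := by
          rw [setLIntegral_const, Real.volume_Ioc, sub_zero, mul_comm (ENNReal.ofReal (1 - ε)),
            ← mul_assoc, hT_inv T hT, one_mul]
      _ ≤ ENNReal.ofReal (1 / T) * ∫⁻ s in Ioc 0 T, M.P s x C := by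
          refine mul_le_mul_right (setLIntegral_mono' measurableSet_Ioc fun s hs => ?_) _
          have := M.prob s x
          have h1 := hle s hs.1.le
          rw [prob_compl_eq_one_sub hCm] at h1
          rw [ENNReal.ofReal_sub _ hε.le, ENNReal.ofReal_one]
          exact tsub_le_iff_right.2 ((tsub_le_iff_right.1 h1).trans_eq (add_comm _ _))
  exact (ENNReal.ofReal_le_iff_le_toReal (hupper.trans_lt ENNReal.one_lt_top).ne).1 hlower
end
end

section
/- Let (ν_n)_{n∈ℕ} be a sequence of Borel probability measures on a Polish metric space (𝒳, ρ) which is not tight. Then there exist ε > 0, a sequence (K_i) of compact subsets of 𝒳, and a strictly increasing sequence (n_i) of positive integers such that ν_{n_i}(K_i) ≥ ε for every i, and ρ(x,y) ≥ ε for all x ∈ K_i, y ∈ K_j whenever i ≠ j. -/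
open MeasureTheory Filter Topology Metric Set

noncomputable section

/-- A set of measures on a complete metric space is tight as soon as, for every `δ > 0`, the
`δ`-thickening of some compact set carries all but `δ` of the mass of each of them. -/
theorem isTightMeasureSet_of_measure_compl_thickening_le
    {X : Type*} [MetricSpace X] [CompleteSpace X] [MeasurableSpace X]
    {S : Set (Measure X)}
    (h : ∀ δ : ℝ, 0 < δ → ∃ K : Set X, IsCompact K ∧
      ∀ μ ∈ S, μ (thickening δ K)ᶜ ≤ ENNReal.ofReal δ) :
    IsTightMeasureSet S := by
  rw [isTightMeasureSet_iff_exists_isCompact_measure_compl_le]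
  intro ε hε
  obtain ⟨η, hη, hsum⟩ := ENNReal.exists_pos_sum_of_countable hε.ne' ℕ
  set δ : ℕ → ℝ := fun k => min (η k : ℝ) (1 / ((k : ℝ) + 1))
  have hδ : ∀ k, 0 < δ k := fun k => lt_min (hη k) Nat.one_div_pos_of_nat
  choose K hK hKS using fun k => h (δ k) (hδ k)
  refine ⟨⋂ k, cthickening (δ k) (K k), TotallyBounded.isCompact_of_isClosed ?_
    (isClosed_iInter fun k => isClosed_cthickening), fun μ hμ => ?_⟩
  · refine Metric.totallyBounded_iff.2 fun r hr => ?_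
    obtain ⟨k, hk⟩ := exists_nat_one_div_lt (half_pos hr)
    obtain ⟨t, ht, hKt⟩ := Metric.totallyBounded_iff.1 (hK k).totallyBounded (r / 2) (half_pos hr)
    refine ⟨t, ht, fun x hx => ?_⟩
    have hx' : x ∈ thickening (r / 2) (K k) :=
      cthickening_subset_thickening' (half_pos hr) ((min_le_right _ _).trans_lt hk) _
        (mem_iInter.1 hx k)
    obtain ⟨z, hz, hxz⟩ := mem_thickening_iff.1 hx'
    obtain ⟨y, hy, hzy⟩ := mem_iUnion₂.1 (hKt hz)
    rw [mem_ball] at hzy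
    exact mem_iUnion₂.2 ⟨y, hy, mem_ball.2 (by linarith [dist_triangle x z y])⟩
  · rw [compl_iInter]
    calc μ (⋃ k, (cthickening (δ k) (K k))ᶜ)
        ≤ ∑' k, μ (cthickening (δ k) (K k))ᶜ := measure_iUnion_le _
      _ ≤ ∑' k, (η k : ENNReal) := ENNReal.tsum_le_tsum fun k =>
          (measure_mono (compl_subset_compl.2 (thickening_subset_cthickening _ _))).trans <|
            (hKS k μ hμ).trans <| (ENNReal.ofReal_le_ofReal (min_le_left _ _)).trans_eq
              ENNReal.ofReal_coe_nnreal
      _ ≤ ε := hsum.le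

/-- If a sequence of finite measures is not tight, then for some `ε > 0` infinitely many of them
give mass more than `ε` to the complement of the `ε`-thickening of any given compact set. -/
theorem exists_lt_measure_compl_thickening_of_not_isTightMeasureSet
    {X : Type*} [MetricSpace X] [CompleteSpace X] [SecondCountableTopology X]
    [MeasurableSpace X] [BorelSpace X] {ν : ℕ → Measure X} [∀ n, IsFiniteMeasure (ν n)]
    (h : ¬ IsTightMeasureSet (range ν)) :
    ∃ ε : ℝ, 0 < ε ∧ ∀ K : Set X, IsCompact K → ∀ N : ℕ, ∃ n, N < n ∧
      ENNReal.ofReal ε < ν n (thickening ε K)ᶜ := by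
  contrapose! h
  refine isTightMeasureSet_of_measure_compl_thickening_le fun δ hδ => ?_
  obtain ⟨K, hK, N, hN⟩ := h δ hδ
  have hsingle : ∀ n, ∃ L : Set X, IsCompact L ∧ ν n Lᶜ ≤ ENNReal.ofReal δ := fun n => by
    obtain ⟨L, hL, hLn⟩ := isTightMeasureSet_iff_exists_isCompact_measure_compl_le.1
      (isTightMeasureSet_singleton (μ := ν n)) _ (ENNReal.ofReal_pos.2 hδ)
    exact ⟨L, hL, hLn _ rfl⟩
  choose L hL hLn using hsingle
  refine ⟨K ∪ ⋃ n ∈ Iic N, L n,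
    hK.union ((finite_Iic N).isCompact_biUnion fun n _ => hL n), ?_⟩
  rintro _ ⟨n, rfl⟩
  rcases lt_or_ge N n with hn | hn
  · exact (measure_mono (compl_subset_compl.2
      (thickening_subset_of_subset _ subset_union_left))).trans (hN n hn)
  · exact (measure_mono (compl_subset_compl.2
      (((subset_biUnion_of_mem (u := L) (mem_Iic.2 hn)).trans subset_union_right).trans
        (self_subset_thickening hδ _)))).trans (hLn n)

/-- Lemma 1 of the paper, after Lasota–Szarek. If a sequence of Borel
probability measures on a Polish space is not tight, then there are `ε > 0`, compact
sets `K_i` pairwise `ε`-separated, and a strictly increasing sequence of positive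
integers `n_i` with `ν_{n_i}(K_i) ≥ ε` for all `i`. -/
theorem exists_separated_compacts_of_not_tight
    {X : Type*} [MetricSpace X] [CompleteSpace X] [SecondCountableTopology X]
    [MeasurableSpace X] [BorelSpace X]
    (ν : ℕ → MeasureTheory.Measure X)
    (hν : ∀ n, MeasureTheory.IsProbabilityMeasure (ν n))
    (hnt : ¬ (∀ ε : ℝ, 0 < ε → ∃ K : Set X, IsCompact K ∧
      ∀ n : ℕ, 1 - ε ≤ ((ν n) K).toReal)) :
    ∃ ε : ℝ, 0 < ε ∧ ∃ K : ℕ → Set X, ∃ a : ℕ → ℕ,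
      StrictMono a ∧ (∀ i, 0 < a i) ∧ (∀ i, IsCompact (K i)) ∧
      (∀ i, ENNReal.ofReal ε ≤ (ν (a i)) (K i)) ∧
      (∀ i j : ℕ, i ≠ j → ∀ x ∈ K i, ∀ y ∈ K j, ε ≤ dist x y) := by
  have hnt' : ¬ IsTightMeasureSet (range ν) := by
    refine fun ht => hnt fun ε hε => ?_
    obtain ⟨K, hK, hKν⟩ := isTightMeasureSet_iff_exists_isCompact_measure_compl_le.1 ht _
      (ENNReal.ofReal_pos.2 hε)
    refine ⟨K, hK, fun n => ?_⟩
    have hcompl : (ν n).real Kᶜ ≤ ε :=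
      ENNReal.toReal_le_of_le_ofReal hε.le (hKν _ (mem_range_self n))
    rw [probReal_compl_eq_one_sub hK.measurableSet] at hcompl
    change 1 - ε ≤ (ν n).real K
    linarith
  obtain ⟨ε, hε, hfar⟩ := exists_lt_measure_compl_thickening_of_not_isTightMeasureSet hnt'
  obtain ⟨f, hf, hff⟩ := exists_seq_of_forall_finset_exists
    (fun p : Set X × ℕ => 0 < p.2 ∧ IsCompact p.1 ∧ ENNReal.ofReal ε ≤ ν p.2 p.1)
    (fun p q => p.2 < q.2 ∧ ∀ x ∈ p.1, ∀ y ∈ q.1, ε ≤ dist x y) (by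
      intro s hs
      obtain ⟨n, hn, hmass⟩ := hfar (⋃ p ∈ s, p.1)
        (s.isCompact_biUnion fun p hp => (hs p hp).2.1) (s.sup Prod.snd)
      obtain ⟨L, hL, hLc, hLn⟩ :=
        isOpen_thickening.measurableSet.compl.exists_lt_isCompact hmass
      refine ⟨(L, n), ⟨by omega, hLc, hLn.le⟩, fun p hp =>
        ⟨(Finset.le_sup (f := Prod.snd) hp).trans_lt hn, fun x hx y hy => ?_⟩⟩
      by_contra! hxy
      exact hL hy (mem_thickening_iff.2 ⟨x, mem_iUnion₂.2 ⟨p, hp, hx⟩, by rwa [dist_comm]⟩))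
  refine ⟨ε, hε, fun i => (f i).1, fun i => (f i).2, fun i j hij => (hff i j hij).1,
    fun i => (hf i).1, fun i => (hf i).2.1, fun i => (hf i).2.2, fun i j hij x hx y hy => ?_⟩
  rcases hij.lt_or_gt with hlt | hlt
  · exact (hff i j hlt).2 x hx y hy
  · rw [dist_comm]
    exact (hff j i hlt).2 y hy x hx
end
end
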